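/- Let μ be a clause type distribution satisfying hypothesis H2, and let ψ_n(α) := (1/n)·E[log Z(F(α,n,μ)) | Z(F(α,n,μ)) ≥ 1]. Then for every α < α*(μ), ψ_n(α) converges as n → ∞ to a limit φ_s(α). -/

import Mathlib

open Filter
open scoped Classical Topology BigOperators

noncomputable section

/-- A clause type on `k` Boolean variables: a Boolean function `{-1,+1}^k → {0,1}`
(we encode `{-1,+1}` by `Bool`, `true ↔ +1`, and `{0,1}` by `Bool`). -/
abbrev CT (k : ℕ) : Type := (Fin k → Bool) → Bool

/-- `μ` is a probability distribution on the finite type `ι`. -/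
def IsPMF {ι : Type*} [Fintype ι] (μ : ι → ℝ) : Prop :=
  (∀ i, 0 ≤ μ i) ∧ ∑ i, μ i = 1

/-- A clause of a general CSP formula: `k` variable indices together with a clause type. -/
abbrev ClauseG (n k : ℕ) : Type := (Fin k → Fin n) × CT k

/-- An assignment satisfies a clause iff the clause type evaluates to `1` on the
values of the chosen variables. -/
def satC {n k : ℕ} (x : Fin n → Bool) (c : ClauseG n k) : Prop :=
  c.2 (fun j => x (c.1 j)) = true

/-- The number of assignments satisfying all the clauses `f 0, …, f (m-1)`. -/
def ZC {n k m : ℕ} (f : Fin m → ClauseG n k) : ℕ :=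
  (Finset.univ.filter fun x : Fin n → Bool => ∀ a : Fin m, satC x (f a)).card

/-- The probability of drawing the clauses `f 0, …, f (m-1)` when each clause has its `k`
indices i.i.d. uniform in `Fin n` and its clause type drawn from `μ`, independently. -/
def wG {n k m : ℕ} (μ : CT k → ℝ) (f : Fin m → ClauseG n k) : ℝ :=
  ∏ a : Fin m, ((1 : ℝ) / (n : ℝ) ^ k) * μ (f a).2

/-- `P_n(α, φ, μ) = ℙ{Z(F(α,n,μ)) < 2^{nφ}}` for the ensemble with `⌊αn⌋` clauses. -/
def PnG (k n : ℕ) (α φ : ℝ) (μ : CT k → ℝ) : ℝ :=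
  ∑ f : Fin ⌊α * (n : ℝ)⌋₊ → ClauseG n k,
    if (ZC f : ℝ) < (2 : ℝ) ^ ((n : ℝ) * φ) then wG μ f else 0

/-- `α*(μ) = sup{α : P_n(α,0,μ) = O(1/(log n)^{1+ε}) for some ε > 0}`. -/
def alphaStarG (k : ℕ) (μ : CT k → ℝ) : ℝ :=
  sSup {α : ℝ | ∃ ε : ℝ, 0 < ε ∧ ∃ C : ℝ,
    ∀ᶠ (n : ℕ) in atTop, PnG k n α 0 μ ≤ C / Real.log n ^ (1 + ε)}

/-- `v_θ(x) = ∏ᵢ (1 + xᵢ θ)/2`, the biased product measure on `{-1,1}^k`. -/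
def vtheta {k : ℕ} (θ : ℝ) (x : Fin k → Bool) : ℝ :=
  ∏ i : Fin k, (1 + (if x i then (1 : ℝ) else -1) * θ) / 2

/-- `‖φ‖_θ² = ∑_x φ(x)² v_θ(x)`, the `v_θ`-probability that the clause type is satisfied. -/
def normSq {k : ℕ} (φ : CT k) (θ : ℝ) : ℝ :=
  ∑ x : Fin k → Bool, (if φ x then (1 : ℝ) else 0) * vtheta θ x

/-- Hypothesis H1: (a) dominance of balanced assignments, i.e. for all `θ ∈ [-1,1]`,
`E_φ log ‖φ‖_θ ≤ E_φ log ‖φ‖` with equality only at `θ = 0`; and (b) unsatisfiability of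
uniform assignments: for each `s ∈ {-1,+1}` some clause type in the support of `μ`
vanishes at `(s,…,s)`. -/
def H1 (k : ℕ) (μ : CT k → ℝ) : Prop :=
  (∀ θ ∈ Set.Icc (-1 : ℝ) 1,
    (∑ φ : CT k, μ φ * Real.log (Real.sqrt (normSq φ θ))) ≤
        (∑ φ : CT k, μ φ * Real.log (Real.sqrt (normSq φ 0))) ∧
      ((∑ φ : CT k, μ φ * Real.log (Real.sqrt (normSq φ θ))) =
          (∑ φ : CT k, μ φ * Real.log (Real.sqrt (normSq φ 0))) → θ = 0)) ∧
  (∀ s : Bool, ∃ φ : CT k, 0 < μ φ ∧ φ (fun _ => s) = false)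

/-- `Γ_l(ν) = E_φ E ∏_{r=1}^l (1 - φ(Z^{(r)}))`, where `Z_i = (Z_i^{(1)},…,Z_i^{(l)})`,
`i = 1,…,k`, are i.i.d. with distribution `ν` on `{-1,1}^l` and `φ ~ μ`. -/
def Gam (k : ℕ) (μ : CT k → ℝ) (l : ℕ) (ν : (Fin l → Bool) → ℝ) : ℝ :=
  ∑ φ : CT k, μ φ *
    ∑ z : Fin k → Fin l → Bool,
      (∏ i : Fin k, ν (z i)) * ∏ r : Fin l, (if φ (fun i => z i r) then (0 : ℝ) else 1)

/-- Hypothesis H2: `Γ_l` is convex on the simplex of probability measures on `{-1,1}^l`,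
for every `l ≥ 1`. -/
def H2 (k : ℕ) (μ : CT k → ℝ) : Prop :=
  ∀ l : ℕ, 1 ≤ l → ConvexOn ℝ (stdSimplex ℝ (Fin l → Bool)) (Gam k μ l)

/-- `ψ_n(α) = (1/n) E[log Z(F(α,n,μ)) | Z(F(α,n,μ)) ≥ 1]`. -/
def psinG (k n : ℕ) (α : ℝ) (μ : CT k → ℝ) : ℝ :=
  (1 / (n : ℝ)) *
    ((∑ f : Fin ⌊α * (n : ℝ)⌋₊ → ClauseG n k,
        if 1 ≤ ZC f then wG μ f * Real.log (ZC f) else 0) /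
      (∑ f : Fin ⌊α * (n : ℝ)⌋₊ → ClauseG n k, if 1 ≤ ZC f then wG μ f else 0))

/-- The push-forward of a weight function along a map. -/
def pushWeight {β γ : Type*} [Fintype β] (h : β → γ) (w : β → ℝ) (c : γ) : ℝ :=
  ∑ b, if h b = c then w b else 0

/-- The assignments satisfying the clause `c`. -/
def satSet {k : ℕ} {V : Type*} [Fintype V] (c : (Fin k → V) × CT k) : Finset (V → Bool) :=
  Finset.univ.filter fun x => c.2 (fun j => x (c.1 j)) = true

/-- The probability of a clause whose indices are i.i.d. with law `w`. -/
def clauseWeight {k : ℕ} {V : Type*} (μ : CT k → ℝ) (w : V → ℝ) (c : (Fin k → V) × CT k) : ℝ :=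
  (∏ j, w (c.1 j)) * μ c.2

/-- The Markov operator on functions of the solution set describing the addition of a random
clause with variable law `w`. -/
def addClause {k : ℕ} {V : Type*} [Fintype V] (μ : CT k → ℝ) (w : V → ℝ) :
    Module.End ℝ (Finset (V → Bool) → ℝ) where
  toFun F := fun S => ∑ c : (Fin k → V) × CT k, clauseWeight μ w c * F (S ∩ satSet c)
  map_add' F G := by
    ext S
    simp [mul_add, Finset.sum_add_distrib]
  map_smul' a F := by
    ext S
    simp only [Pi.smul_apply, smul_eq_mul, RingHom.id_apply, Finset.mul_sum]
    exact Finset.sum_congr rfl fun c _ => by ring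

lemma addClause_apply {k : ℕ} {V : Type*} [Fintype V] (μ : CT k → ℝ) (w : V → ℝ)
    (F : Finset (V → Bool) → ℝ) (S : Finset (V → Bool)) :
    addClause μ w F S =
      ∑ c : (Fin k → V) × CT k, clauseWeight μ w c * F (S ∩ satSet c) := rfl

lemma sum_prod_pushWeight {k : ℕ} {β γ : Type*} [Fintype β] [Fintype γ] (h : β → γ) (w : β → ℝ)
    (G : (Fin k → γ) → ℝ) :
    ∑ z : Fin k → γ, (∏ i, pushWeight h w (z i)) * G z =
      ∑ a : Fin k → β, (∏ i, w (a i)) * G (fun i => h (a i)) := by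
  have h1 : ∀ z : Fin k → γ, ∏ i, pushWeight h w (z i) =
      ∑ a : Fin k → β, if (fun i => h (a i)) = z then ∏ i, w (a i) else 0 := by
    intro z
    unfold pushWeight
    rw [Finset.prod_univ_sum, Fintype.piFinset_univ]
    refine Finset.sum_congr rfl fun a _ => ?_
    split_ifs with hz
    · exact Finset.prod_congr rfl fun i _ => by rw [← hz]; simp
    · obtain ⟨i, hi⟩ := Function.ne_iff.mp hz
      exact Finset.prod_eq_zero (Finset.mem_univ i) (if_neg hi)
  simp_rw [h1, Finset.sum_mul]
  rw [Finset.sum_comm]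
  refine Finset.sum_congr rfl fun a _ => ?_
  simp [ite_mul]

lemma pushWeight_mem_stdSimplex {β γ : Type*} [Fintype β] [Fintype γ] (h : β → γ) {w : β → ℝ}
    (hw : IsPMF w) : pushWeight h w ∈ stdSimplex ℝ γ := by
  refine ⟨fun c => Finset.sum_nonneg fun b _ => by split_ifs <;> simp [hw.1], ?_⟩
  unfold pushWeight
  rw [Finset.sum_comm, ← hw.2]
  simp

lemma pushWeight_isPMF {β γ : Type*} [Fintype β] [Fintype γ] (h : β → γ) {w : β → ℝ}
    (hw : IsPMF w) : IsPMF (pushWeight h w) :=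
  pushWeight_mem_stdSimplex h hw

lemma clauseWeight_isPMF {k : ℕ} {V : Type*} [Fintype V] {μ : CT k → ℝ} {w : V → ℝ}
    (hμ : IsPMF μ) (hw : IsPMF w) :
    IsPMF (fun c : (Fin k → V) × CT k => clauseWeight μ w c) := by
  refine ⟨fun c => mul_nonneg (Finset.prod_nonneg fun j _ => hw.1 _) (hμ.1 _), ?_⟩
  unfold clauseWeight
  rw [Fintype.sum_prod_type]
  simp only [← Finset.mul_sum, hμ.2, mul_one]
  rw [← Fintype.sum_pow, hw.2, one_pow]

/-- The probability that all of `l` given assignments violate a random clause, as a value of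
`Gam` at the empirical law of the replicas. -/
lemma sum_clauseWeight_violated {k : ℕ} {V : Type*} [Fintype V] (μ : CT k → ℝ) (w : V → ℝ)
    {l : ℕ} (x : Fin l → V → Bool) :
    ∑ c : (Fin k → V) × CT k, clauseWeight μ w c *
        ∏ r, (if x r ∈ satSet c then (0 : ℝ) else 1) =
      Gam k μ l (pushWeight (fun v r => x r v) w) := by
  unfold Gam clauseWeight
  rw [Fintype.sum_prod_type, Finset.sum_comm]
  refine Finset.sum_congr rfl fun φ _ => ?_
  rw [sum_prod_pushWeight (fun v r => x r v) w
    (fun z => ∏ r : Fin l, (if φ (fun i => z i r) then (0 : ℝ) else 1)), Finset.mul_sum]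
  refine Finset.sum_congr rfl fun a _ => ?_
  simp only [satSet, Finset.mem_filter, Finset.mem_univ, true_and]
  ring

lemma sum_clauseWeight_pow {k : ℕ} {V : Type*} [Fintype V] (μ : CT k → ℝ) (w : V → ℝ)
    (S : Finset (V → Bool)) (l : ℕ) :
    ∑ c : (Fin k → V) × CT k, clauseWeight μ w c * ((S \ satSet c).card : ℝ) ^ l =
      ∑ x ∈ Fintype.piFinset fun _ : Fin l => S,
        Gam k μ l (pushWeight (fun v r => x r v) w) := by
  simp_rw [← sum_clauseWeight_violated]
  rw [Finset.sum_comm]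
  refine Finset.sum_congr rfl fun c _ => ?_
  rw [← Finset.mul_sum]
  congr 1
  have : ((S \ satSet c).card : ℝ) = ∑ x ∈ S, if x ∈ satSet c then (0 : ℝ) else 1 := by
    rw [Finset.card_eq_sum_ones, ← Finset.filter_notMem_eq_sdiff, Finset.sum_filter]
    push_cast
    exact Finset.sum_congr rfl fun x _ => by split_ifs <;> simp_all
  rw [this, Finset.sum_pow']

/-- Logarithm of one plus the number of solutions. -/
def logCard {V : Type*} [Fintype V] (S : Finset (V → Bool)) : ℝ := Real.log (1 + S.card)

lemma hasSum_logCard_inter {V : Type*} [Fintype V] (S C : Finset (V → Bool)) :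
    HasSum (fun l : ℕ => ((S \ C).card / (1 + S.card : ℝ)) ^ (l + 1) / (l + 1))
      (logCard S - logCard (S ∩ C)) := by
  have hc : ((S \ C).card : ℝ) + (S ∩ C).card = S.card := by
    exact_mod_cast Finset.card_sdiff_add_card_inter S C
  have hpos : (0 : ℝ) < 1 + S.card := by positivity
  have hi : (0 : ℝ) ≤ (S ∩ C).card := by positivity
  have hlt : |((S \ C).card / (1 + S.card : ℝ))| < 1 := by
    rw [abs_of_nonneg (by positivity), div_lt_one hpos]
    linarith
  convert Real.hasSum_pow_div_log_of_abs_lt_one hlt using 1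
  have : 1 - ((S \ C).card / (1 + S.card : ℝ)) = (1 + (S ∩ C).card) / (1 + S.card) := by
    field_simp
    linarith
  rw [this, Real.log_div (by positivity) (by positivity)]
  unfold logCard
  ring

lemma pushWeight_add_smul {β γ : Type*} [Fintype β] (h : β → γ) (w₁ w₂ : β → ℝ) (p q : ℝ) :
    pushWeight h (p • w₁ + q • w₂) = p • pushWeight h w₁ + q • pushWeight h w₂ := by
  ext c
  simp only [pushWeight, Pi.add_apply, Pi.smul_apply, smul_eq_mul, Finset.mul_sum,
    ← Finset.sum_add_distrib]
  exact Finset.sum_congr rfl fun b _ => by split_ifs <;> simp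

lemma logCard_addClause_concave {k : ℕ} {V : Type*} [Fintype V] {μ : CT k → ℝ} (hμ : IsPMF μ)
    (h2 : H2 k μ) {w₁ w₂ : V → ℝ} (hw₁ : IsPMF w₁) (hw₂ : IsPMF w₂) {p q : ℝ} (hp : 0 ≤ p)
    (hq : 0 ≤ q) (hpq : p + q = 1) (S : Finset (V → Bool)) :
    p * addClause μ w₁ logCard S + q * addClause μ w₂ logCard S ≤
      addClause μ (p • w₁ + q • w₂) logCard S := by
  have hw : IsPMF (p • w₁ + q • w₂) := by
    refine ⟨fun v => by
      have := hw₁.1 v; have := hw₂.1 v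
      simp only [Pi.add_apply, Pi.smul_apply, smul_eq_mul]; positivity, ?_⟩
    simp [Finset.sum_add_distrib, ← Finset.mul_sum, hw₁.2, hw₂.2, hpq]
  have hsum : ∀ w : V → ℝ, IsPMF w → HasSum (fun l : ℕ =>
      ∑ c : (Fin k → V) × CT k, clauseWeight μ w c *
        (((S \ satSet c).card / (1 + S.card : ℝ)) ^ (l + 1) / (l + 1)))
      (logCard S - addClause μ w logCard S) := by
    intro w hw
    have h1 := hasSum_sum (s := Finset.univ) fun (c : (Fin k → V) × CT k) _ =>
      (hasSum_logCard_inter S (satSet c)).mul_left (clauseWeight μ w c)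
    have h3 : logCard S - addClause μ w logCard S = ∑ c : (Fin k → V) × CT k,
        clauseWeight μ w c * (logCard S - logCard (S ∩ satSet c)) := by
      rw [addClause_apply]
      simp only [mul_sub, Finset.sum_sub_distrib, ← Finset.sum_mul,
        (clauseWeight_isPMF hμ hw).2, one_mul]
    rw [h3]
    exact h1
  have hs := hsum _ hw
  have hs' := ((hsum _ hw₁).mul_left p).add ((hsum _ hw₂).mul_left q)
  have key := hasSum_le (fun l => ?_) hs hs'
  · have h3 : p * logCard S + q * logCard S = logCard S := by rw [← add_mul, hpq, one_mul]
    linarith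
  have hmul : ∀ w : V → ℝ, ∑ c : (Fin k → V) × CT k, clauseWeight μ w c *
        (((S \ satSet c).card / (1 + S.card : ℝ)) ^ (l + 1) / (l + 1)) =
      (1 / ((1 + S.card : ℝ) ^ (l + 1) * (l + 1))) *
        ∑ c : (Fin k → V) × CT k, clauseWeight μ w c * ((S \ satSet c).card : ℝ) ^ (l + 1) := by
    intro w
    rw [Finset.mul_sum]
    refine Finset.sum_congr rfl fun c _ => ?_
    rw [div_pow]
    field_simp
  rw [hmul, hmul, hmul]
  rw [← mul_assoc, ← mul_assoc, mul_comm p, mul_comm q, mul_assoc, mul_assoc, ← mul_add]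
  refine mul_le_mul_of_nonneg_left ?_ (by positivity)
  simp_rw [sum_clauseWeight_pow, Finset.mul_sum]
  rw [← Finset.sum_add_distrib]
  refine Finset.sum_le_sum fun x _ => ?_
  rw [pushWeight_add_smul]
  exact (h2 (l + 1) (by omega)).2 (pushWeight_mem_stdSimplex _ hw₁)
    (pushWeight_mem_stdSimplex _ hw₂) hp hq hpq

lemma addClause_monotone {k : ℕ} {V : Type*} [Fintype V] {μ : CT k → ℝ} (hμ : IsPMF μ)
    {w : V → ℝ} (hw : IsPMF w) : Monotone (addClause μ w) := by
  intro F G h S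
  rw [addClause_apply, addClause_apply]
  exact Finset.sum_le_sum fun c _ =>
    mul_le_mul_of_nonneg_left (h _) ((clauseWeight_isPMF hμ hw).1 c)

lemma addClause_commute {k : ℕ} {V : Type*} [Fintype V] (μ : CT k → ℝ) (w₁ w₂ : V → ℝ) :
    Commute (addClause μ w₁) (addClause μ w₂) := by
  refine LinearMap.ext fun F => funext fun S => ?_
  simp only [Module.End.mul_apply, addClause_apply, Finset.mul_sum]
  rw [Finset.sum_comm]
  refine Finset.sum_congr rfl fun c _ => Finset.sum_congr rfl fun d _ => ?_
  rw [Finset.inter_right_comm]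
  ring

lemma monotone_pow_end {ι : Type*} {X : Module.End ℝ (ι → ℝ)} (hX : Monotone X) (m : ℕ) :
    Monotone (X ^ m) := by
  rw [Module.End.coe_pow]
  exact hX.iterate m

lemma pow_end_le_pow_end {ι : Type*} {X Y : Module.End ℝ (ι → ℝ)} (hX : Monotone X)
    (hY : Monotone Y) (hXY : Commute X Y) {f : ι → ℝ} (h : Y f ≤ X f) (m : ℕ) :
    (Y ^ m) f ≤ (X ^ m) f := by
  induction m with
  | zero => simp
  | succ m ih =>
    calc (Y ^ (m + 1)) f = (Y ^ m) (Y f) := by rw [pow_succ, Module.End.mul_apply]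
      _ ≤ (Y ^ m) (X f) := monotone_pow_end hY m h
      _ = X ((Y ^ m) f) := by
        rw [← Module.End.mul_apply, ← Module.End.mul_apply, (hXY.pow_right m).eq]
      _ ≤ X ((X ^ m) f) := hX ih
      _ = (X ^ (m + 1)) f := by rw [pow_succ', Module.End.mul_apply]

lemma monotone_smul_add_smul {ι : Type*} {X Y : Module.End ℝ (ι → ℝ)} (hX : Monotone X)
    (hY : Monotone Y) {p q : ℝ} (hp : 0 ≤ p) (hq : 0 ≤ q) : Monotone (p • X + q • Y) := by
  intro f g h i
  have h1 := hX h i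
  have h2 := hY h i
  simp only [LinearMap.add_apply, LinearMap.smul_apply, Pi.add_apply, Pi.smul_apply, smul_eq_mul]
  gcongr

/-- Interpolation between the full formula and the formula split into two blocks. -/
lemma split_pow_le_addClause_pow {k : ℕ} {V : Type*} [Fintype V] {μ : CT k → ℝ} (hμ : IsPMF μ)
    (h2 : H2 k μ) {w₁ w₂ : V → ℝ} (hw₁ : IsPMF w₁) (hw₂ : IsPMF w₂) {p q : ℝ} (hp : 0 ≤ p)
    (hq : 0 ≤ q) (hpq : p + q = 1) (hw : IsPMF (p • w₁ + q • w₂)) (m : ℕ) :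
    ((p • addClause μ w₁ + q • addClause μ w₂) ^ m) logCard ≤
      (addClause μ (p • w₁ + q • w₂) ^ m) logCard := by
  refine pow_end_le_pow_end (addClause_monotone hμ hw)
    (monotone_smul_add_smul (addClause_monotone hμ hw₁) (addClause_monotone hμ hw₂) hp hq)
    (((addClause_commute μ _ _).smul_right _).add_right
      ((addClause_commute μ _ _).smul_right _)) ?_ m
  intro S
  exact logCard_addClause_concave hμ h2 hw₁ hw₂ hp hq hpq S

/-- The assignments whose restrictions to the two blocks lie in `S₁` and `S₂`. -/
def joinSet {V V₁ V₂ : Type*} [Fintype V] (e₁ : V₁ → V) (e₂ : V₂ → V)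
    (S₁ : Finset (V₁ → Bool)) (S₂ : Finset (V₂ → Bool)) : Finset (V → Bool) :=
  Finset.univ.filter fun x => (fun i => x (e₁ i)) ∈ S₁ ∧ (fun i => x (e₂ i)) ∈ S₂

lemma addClause_pushWeight {k : ℕ} {V V₁ : Type*} [Fintype V] [Fintype V₁] (μ : CT k → ℝ)
    (e : V₁ → V) (w : V₁ → ℝ) (F : Finset (V → Bool) → ℝ) (S : Finset (V → Bool)) :
    addClause μ (pushWeight e w) F S = ∑ c : (Fin k → V₁) × CT k,
      clauseWeight μ w c * F (S ∩ satSet (fun j => e (c.1 j), c.2)) := by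
  rw [addClause_apply, Fintype.sum_prod_type, Fintype.sum_prod_type, Finset.sum_comm]
  conv_rhs => rw [Finset.sum_comm]
  refine Finset.sum_congr rfl fun φ _ => ?_
  have := sum_prod_pushWeight e w (fun z : Fin k → V => μ φ * F (S ∩ satSet (z, φ)))
  simpa only [clauseWeight, mul_assoc] using this

lemma joinSet_inter_left {k : ℕ} {V V₁ V₂ : Type*} [Fintype V] [Fintype V₁] [Fintype V₂]
    (e₁ : V₁ → V) (e₂ : V₂ → V) (S₁ : Finset (V₁ → Bool)) (S₂ : Finset (V₂ → Bool))
    (c : (Fin k → V₁) × CT k) :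
    joinSet e₁ e₂ S₁ S₂ ∩ satSet (fun j => e₁ (c.1 j), c.2) =
      joinSet e₁ e₂ (S₁ ∩ satSet c) S₂ := by
  ext x
  simp only [joinSet, satSet, Finset.mem_inter, Finset.mem_filter, Finset.mem_univ, true_and]
  tauto

lemma joinSet_inter_right {k : ℕ} {V V₁ V₂ : Type*} [Fintype V] [Fintype V₁] [Fintype V₂]
    (e₁ : V₁ → V) (e₂ : V₂ → V) (S₁ : Finset (V₁ → Bool)) (S₂ : Finset (V₂ → Bool))
    (c : (Fin k → V₂) × CT k) :
    joinSet e₁ e₂ S₁ S₂ ∩ satSet (fun j => e₂ (c.1 j), c.2) =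
      joinSet e₁ e₂ S₁ (S₂ ∩ satSet c) := by
  ext x
  simp only [joinSet, satSet, Finset.mem_inter, Finset.mem_filter, Finset.mem_univ, true_and]
  tauto

/-- Apply `X` with probability `p` and do nothing with probability `q`. -/
def thin {ι : Type*} (p q : ℝ) (X : Module.End ℝ (ι → ℝ)) : Module.End ℝ (ι → ℝ) :=
  p • X + q • 1

lemma separated_le_split_pow {k : ℕ} {V V₁ V₂ : Type*} [Fintype V] [Fintype V₁] [Fintype V₂]
    {μ : CT k → ℝ} (hμ : IsPMF μ) (e₁ : V₁ → V) (e₂ : V₂ → V) {w₁ : V₁ → ℝ} {w₂ : V₂ → ℝ}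
    (hw₁ : IsPMF w₁) (hw₂ : IsPMF w₂) {p q : ℝ} (hp : 0 ≤ p) (hq : 0 ≤ q) (hpq : p + q = 1)
    (a : ℝ) (m : ℕ) (F : Finset (V → Bool) → ℝ) (u : Finset (V₁ → Bool) → ℝ)
    (v : Finset (V₂ → Bool) → ℝ)
    (h : ∀ S₁ S₂, u S₁ + v S₂ ≤ F (joinSet e₁ e₂ S₁ S₂) + a) (S₁ : Finset (V₁ → Bool))
    (S₂ : Finset (V₂ → Bool)) :
    (thin p q (addClause μ w₁) ^ m) u S₁ +
        (thin q p (addClause μ w₂) ^ m) v S₂ ≤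
      ((p • addClause μ (pushWeight e₁ w₁) + q • addClause μ (pushWeight e₂ w₂)) ^ m) F
        (joinSet e₁ e₂ S₁ S₂) + a := by
  induction m generalizing F u v with
  | zero => simpa using h S₁ S₂
  | succ m ih =>
    rw [pow_succ, pow_succ, pow_succ, Module.End.mul_apply, Module.End.mul_apply,
      Module.End.mul_apply]
    refine ih _ _ _ fun R₁ R₂ => ?_
    simp only [thin, LinearMap.add_apply, LinearMap.smul_apply, Pi.add_apply, Pi.smul_apply,
      smul_eq_mul, Module.End.one_apply, addClause_pushWeight, joinSet_inter_left,
      joinSet_inter_right]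
    have h1 : addClause μ w₁ u R₁ + v R₂ ≤ ∑ c : (Fin k → V₁) × CT k,
        clauseWeight μ w₁ c * F (joinSet e₁ e₂ (R₁ ∩ satSet c) R₂) + a := by
      have := Finset.sum_le_sum (s := Finset.univ) fun (c : (Fin k → V₁) × CT k) _ =>
        mul_le_mul_of_nonneg_left (h (R₁ ∩ satSet c) R₂) ((clauseWeight_isPMF hμ hw₁).1 c)
      simp only [mul_add, Finset.sum_add_distrib, ← Finset.sum_mul,
        (clauseWeight_isPMF hμ hw₁).2, one_mul] at this
      exact this
    have h2 : u R₁ + addClause μ w₂ v R₂ ≤ ∑ c : (Fin k → V₂) × CT k,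
        clauseWeight μ w₂ c * F (joinSet e₁ e₂ R₁ (R₂ ∩ satSet c)) + a := by
      have := Finset.sum_le_sum (s := Finset.univ) fun (c : (Fin k → V₂) × CT k) _ =>
        mul_le_mul_of_nonneg_left (h R₁ (R₂ ∩ satSet c)) ((clauseWeight_isPMF hμ hw₂).1 c)
      simp only [mul_add, Finset.sum_add_distrib, ← Finset.sum_mul,
        (clauseWeight_isPMF hμ hw₂).2, one_mul] at this
      exact this
    have h3 := mul_le_mul_of_nonneg_left h1 hp
    have h4 := mul_le_mul_of_nonneg_left h2 hq
    have h5 : p * a + q * a = a := by rw [← add_mul, hpq, one_mul]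
    linarith

/-- The indicator of unsatisfiability. -/
def emptyInd {V : Type*} (S : Finset (V → Bool)) : ℝ := if S = ∅ then 1 else 0

/-- The uniform law on the variables. -/
def unif (n : ℕ) : Fin n → ℝ := fun _ => 1 / (n : ℝ)

lemma unif_isPMF {n : ℕ} (hn : 0 < n) : IsPMF (unif n) := by
  refine ⟨fun i => by unfold unif; positivity, ?_⟩
  have : (n : ℝ) ≠ 0 := by positivity
  simp [unif, this]

lemma card_joinSet {n₁ n₂ : ℕ} (S₁ : Finset (Fin n₁ → Bool)) (S₂ : Finset (Fin n₂ → Bool)) :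
    (joinSet (Fin.castAdd n₂) (Fin.natAdd n₁) S₁ S₂).card = S₁.card * S₂.card := by
  rw [← Finset.card_product]
  symm
  refine Finset.card_bij (fun x _ => Fin.append x.1 x.2) ?_ ?_ ?_
  · intro x hx
    rw [Finset.mem_product] at hx
    simpa [joinSet] using hx
  · intro x _ y _ h
    exact (Fin.appendEquiv n₁ n₂).injective h
  · intro x hx
    refine ⟨(fun i => x (Fin.castAdd n₂ i), fun i => x (Fin.natAdd n₁ i)), ?_, ?_⟩
    · simpa [joinSet] using hx
    · exact Fin.append_castAdd_natAdd

lemma pushWeight_unif {n₁ n₂ : ℕ} (h₁ : 0 < n₁) (h₂ : 0 < n₂) :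
    ((n₁ : ℝ) / (n₁ + n₂ : ℕ)) • pushWeight (Fin.castAdd n₂) (unif n₁) +
      ((n₂ : ℝ) / (n₁ + n₂ : ℕ)) • pushWeight (Fin.natAdd n₁) (unif n₂) = unif (n₁ + n₂) := by
  have hn₁ : (n₁ : ℝ) ≠ 0 := by positivity
  have hn₂ : (n₂ : ℝ) ≠ 0 := by positivity
  ext i
  simp only [Pi.add_apply, Pi.smul_apply, smul_eq_mul, pushWeight, unif]
  refine Fin.addCases (fun j => ?_) (fun j => ?_) i
  · have : ∀ b : Fin n₂, Fin.natAdd n₁ b ≠ Fin.castAdd n₂ j := by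
      intro b hb
      have := congrArg Fin.val hb
      simp at this
      omega
    simp [this]
    field_simp
  · have : ∀ b : Fin n₁, Fin.castAdd n₂ b ≠ Fin.natAdd n₁ j := by
      intro b hb
      have := congrArg Fin.val hb
      simp at this
      omega
    simp [this]
    field_simp

lemma log_one_add_card_le {n : ℕ} (S : Finset (Fin n → Bool)) :
    logCard S ≤ (n + 1) * Real.log 2 := by
  have h : S.card ≤ 2 ^ n := by simpa using S.card_le_univ
  have h' : (S.card : ℝ) ≤ 2 ^ n := by exact_mod_cast h
  have h1 : (1 : ℝ) ≤ 2 ^ n := one_le_pow₀ (by norm_num)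
  calc logCard S ≤ Real.log (2 ^ (n + 1)) := by
        unfold logCard
        exact Real.log_le_log (by positivity) (by rw [pow_succ]; linarith)
    _ = (n + 1) * Real.log 2 := by rw [Real.log_pow]; push_cast; ring

lemma logCard_nonneg {V : Type*} [Fintype V] (S : Finset (V → Bool)) : 0 ≤ logCard S := by
  have : (0 : ℝ) ≤ S.card := by positivity
  exact Real.log_nonneg (by linarith)

lemma logCard_separated {n₁ n₂ : ℕ} (S₁ : Finset (Fin n₁ → Bool)) (S₂ : Finset (Fin n₂ → Bool)) :
    (logCard S₁ - ((n₂ + 1) * Real.log 2) * emptyInd S₁) +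
      (logCard S₂ - ((n₁ + 1) * Real.log 2) * emptyInd S₂) ≤
      logCard (joinSet (Fin.castAdd n₂) (Fin.natAdd n₁) S₁ S₂) + 2 * Real.log 2 := by
  have hl : 0 < Real.log 2 := Real.log_pos (by norm_num)
  have b1 := log_one_add_card_le S₁
  have b2 := log_one_add_card_le S₂
  have b3 := logCard_nonneg (joinSet (Fin.castAdd n₂) (Fin.natAdd n₁) S₁ S₂)
  by_cases h1 : S₁ = ∅
  · subst h1
    have h0 : logCard (∅ : Finset (Fin n₁ → Bool)) = 0 := by simp [logCard]
    have h4 : 0 ≤ ((n₁ + 1) * Real.log 2) * emptyInd S₂ := by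
      unfold emptyInd; split_ifs <;> positivity
    have h5 : emptyInd (∅ : Finset (Fin n₁ → Bool)) = 1 := by simp [emptyInd]
    rw [h0, h5]
    linarith
  by_cases h2 : S₂ = ∅
  · subst h2
    have h0 : logCard (∅ : Finset (Fin n₂ → Bool)) = 0 := by simp [logCard]
    have h4 : 0 ≤ ((n₂ + 1) * Real.log 2) * emptyInd S₁ := by
      unfold emptyInd; positivity
    have h5 : emptyInd (∅ : Finset (Fin n₂ → Bool)) = 1 := by simp [emptyInd]
    rw [h0, h5]
    linarith
  have h3 : emptyInd S₁ = 0 := if_neg h1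
  have h4 : emptyInd S₂ = 0 := if_neg h2
  rw [h3, h4]
  have c1 : (1 : ℝ) ≤ S₁.card := by
    exact_mod_cast Finset.card_pos.mpr (Finset.nonempty_iff_ne_empty.mpr h1)
  have c2 : (1 : ℝ) ≤ S₂.card := by
    exact_mod_cast Finset.card_pos.mpr (Finset.nonempty_iff_ne_empty.mpr h2)
  unfold logCard
  rw [card_joinSet]
  have : 2 * Real.log 2 = Real.log 4 := by
    rw [show (4 : ℝ) = 2 ^ 2 by norm_num, Real.log_pow, Nat.cast_ofNat]
  rw [this, mul_zero, mul_zero, sub_zero, sub_zero, ← Real.log_mul (by positivity) (by positivity),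
    ← Real.log_mul (by positivity) (by positivity)]
  refine Real.log_le_log (by positivity) ?_
  push_cast
  nlinarith [mul_nonneg (sub_nonneg.mpr c1) (sub_nonneg.mpr c2)]

lemma joinSet_univ {n n₁ n₂ : ℕ} (e₁ : Fin n₁ → Fin n) (e₂ : Fin n₂ → Fin n) :
    joinSet e₁ e₂ Finset.univ Finset.univ = Finset.univ := by
  ext x
  simp [joinSet]

/-- Expected logarithm of one plus the number of solutions with `m` clauses. -/
def meanLog {k : ℕ} (μ : CT k → ℝ) (n m : ℕ) : ℝ :=
  (addClause μ (unif n) ^ m) logCard Finset.univ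

/-- Probability of unsatisfiability with `m` clauses. -/
def unsatProb {k : ℕ} (μ : CT k → ℝ) (n m : ℕ) : ℝ :=
  (addClause μ (unif n) ^ m) emptyInd Finset.univ

lemma split_le_meanLog {k : ℕ} {μ : CT k → ℝ} (hμ : IsPMF μ) (h2 : H2 k μ) {n₁ n₂ : ℕ}
    (h₁ : 0 < n₁) (h₂ : 0 < n₂) {p q : ℝ} (hp : p = (n₁ : ℝ) / (n₁ + n₂ : ℕ))
    (hq : q = (n₂ : ℝ) / (n₁ + n₂ : ℕ)) (m : ℕ) :
    (thin p q (addClause μ (unif n₁)) ^ m)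
          (logCard - ((n₂ + 1) * Real.log 2) • emptyInd) Finset.univ +
        (thin q p (addClause μ (unif n₂)) ^ m)
          (logCard - ((n₁ + 1) * Real.log 2) • emptyInd) Finset.univ ≤
      meanLog μ (n₁ + n₂) m + 2 * Real.log 2 := by
  have hp0 : 0 ≤ p := by rw [hp]; positivity
  have hq0 : 0 ≤ q := by rw [hq]; positivity
  have hpq : p + q = 1 := by
    rw [hp, hq, ← add_div]; push_cast; exact div_self (by positivity)
  have hw : p • pushWeight (Fin.castAdd n₂) (unif n₁) + q • pushWeight (Fin.natAdd n₁) (unif n₂) =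
      unif (n₁ + n₂) := by
    rw [hp, hq]; exact pushWeight_unif h₁ h₂
  have key := separated_le_split_pow hμ (Fin.castAdd n₂) (Fin.natAdd n₁) (unif_isPMF h₁)
    (unif_isPMF h₂) hp0 hq0 hpq (2 * Real.log 2) m logCard
    (logCard - ((n₂ + 1) * Real.log 2) • emptyInd) (logCard - ((n₁ + 1) * Real.log 2) • emptyInd)
    (fun S₁ S₂ => logCard_separated S₁ S₂) Finset.univ Finset.univ
  rw [joinSet_univ] at key
  refine key.trans (add_le_add ?_ le_rfl)
  have := split_pow_le_addClause_pow hμ h2 (pushWeight_isPMF (Fin.castAdd n₂) (unif_isPMF h₁))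
    (pushWeight_isPMF (Fin.natAdd n₁) (unif_isPMF h₂)) hp0 hq0 hpq
    (by rw [hw]; exact unif_isPMF (by omega)) m Finset.univ
  rw [hw] at this
  exact this

/-- Poisson weights. -/
def poisWeight (lam : ℝ) (m : ℕ) : ℝ := Real.exp (-lam) * (lam ^ m / m.factorial)

/-- The mean of `a M` for a Poisson variable `M` of parameter `lam`. -/
def poisMean (lam : ℝ) (a : ℕ → ℝ) : ℝ := ∑' m, poisWeight lam m * a m

lemma poisWeight_nonneg {lam : ℝ} (h : 0 ≤ lam) (m : ℕ) : 0 ≤ poisWeight lam m := by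
  unfold poisWeight; positivity

lemma hasSum_pow_div_factorial (x : ℝ) :
    HasSum (fun m : ℕ => x ^ m / m.factorial) (Real.exp x) := by
  rw [Real.exp_eq_exp_ℝ]
  exact NormedSpace.expSeries_div_hasSum_exp x

lemma hasSum_poisWeight (lam : ℝ) : HasSum (poisWeight lam) 1 := by
  have := (hasSum_pow_div_factorial lam).mul_left (Real.exp (-lam))
  rwa [← Real.exp_add, neg_add_cancel, Real.exp_zero] at this

lemma summable_poisWeight_mul {lam : ℝ} (h : 0 ≤ lam) {a : ℕ → ℝ} {C : ℝ} (ha : ∀ m, |a m| ≤ C) :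
    Summable fun m => poisWeight lam m * a m := by
  refine Summable.of_norm_bounded ((hasSum_poisWeight lam).summable.mul_right C) fun m => ?_
  rw [norm_mul, Real.norm_of_nonneg (poisWeight_nonneg h m)]
  exact mul_le_mul_of_nonneg_left (ha m) (poisWeight_nonneg h m)

lemma poisMean_le {lam : ℝ} (h : 0 ≤ lam) {a b : ℕ → ℝ} {C D : ℝ} (ha : ∀ m, |a m| ≤ C)
    (hb : ∀ m, |b m| ≤ D) (hab : ∀ m, a m ≤ b m) : poisMean lam a ≤ poisMean lam b :=
  (summable_poisWeight_mul h ha).tsum_le_tsum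
    (fun m => mul_le_mul_of_nonneg_left (hab m) (poisWeight_nonneg h m))
    (summable_poisWeight_mul h hb)

lemma poisMean_const (lam c : ℝ) : poisMean lam (fun _ => c) = c := by
  unfold poisMean
  rw [tsum_mul_right, (hasSum_poisWeight lam).tsum_eq, one_mul]

lemma hasSum_pow_end {ι : Type*} [Fintype ι] (X : Module.End ℝ (ι → ℝ)) (lam : ℝ) (u : ι → ℝ)
    (s : ι) : HasSum (fun m : ℕ => lam ^ m / m.factorial * (X ^ m) u s)
      (NormedSpace.exp (lam • Module.End.toContinuousLinearMap (ι → ℝ) X) u s) := by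
  have h := NormedSpace.exp_series_hasSum_exp' (𝕂 := ℝ)
    (lam • Module.End.toContinuousLinearMap (ι → ℝ) X)
  have h2 := h.mapL ((ContinuousLinearMap.proj (R := ℝ) (φ := fun _ : ι => ℝ) s).comp
    (ContinuousLinearMap.apply ℝ (ι → ℝ) u))
  refine h2.congr_fun fun m => ?_
  rw [smul_pow, ← map_pow, smul_smul]
  change _ = ((m.factorial : ℝ)⁻¹ * lam ^ m) * (X ^ m) u s
  ring

lemma summable_poisWeight_pow_end {ι : Type*} [Fintype ι] (X : Module.End ℝ (ι → ℝ)) (lam : ℝ)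
    (u : ι → ℝ) (s : ι) : Summable fun m : ℕ => poisWeight lam m * (X ^ m) u s := by
  have := (hasSum_pow_end X lam u s).summable.mul_left (Real.exp (-lam))
  simpa only [poisWeight, mul_assoc] using this

lemma poisMean_pow_end {ι : Type*} [Fintype ι] (X : Module.End ℝ (ι → ℝ)) (lam : ℝ) (u : ι → ℝ)
    (s : ι) : poisMean lam (fun m => (X ^ m) u s) =
      Real.exp (-lam) * NormedSpace.exp (lam • Module.End.toContinuousLinearMap (ι → ℝ) X) u s := by
  have := (hasSum_pow_end X lam u s).mul_left (Real.exp (-lam))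
  unfold poisMean poisWeight
  rw [← this.tsum_eq]
  simp only [mul_assoc]

/-- Thinning of a Poisson variable. -/
lemma poisMean_thin {ι : Type*} [Fintype ι] (X : Module.End ℝ (ι → ℝ)) (lam p q : ℝ)
    (hpq : p + q = 1) (u : ι → ℝ) (s : ι) :
    poisMean lam (fun m => (thin p q X ^ m) u s) =
      poisMean (p * lam) (fun m => (X ^ m) u s) := by
  rw [poisMean_pow_end, poisMean_pow_end]
  set x := Module.End.toContinuousLinearMap (ι → ℝ) X with hx
  have h1 : lam • Module.End.toContinuousLinearMap (ι → ℝ) (thin p q X) =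
      algebraMap ℝ _ (q * lam) + (p * lam) • x := by
    rw [thin, map_add, map_smul, map_smul, map_one, Algebra.algebraMap_eq_smul_one, smul_add,
      smul_smul, smul_smul, mul_comm lam p, mul_comm lam q, add_comm]
  let _ : NormedAlgebra ℚ ((ι → ℝ) →L[ℝ] (ι → ℝ)) := NormedAlgebra.restrictScalars ℚ ℝ _
  rw [h1, NormedSpace.exp_add_of_commute (Algebra.commutes _ _), ← NormedSpace.algebraMap_exp_comm,
    ← Real.exp_eq_exp_ℝ, Algebra.algebraMap_eq_smul_one, smul_mul_assoc, one_mul]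
  simp only [smul_apply, Pi.smul_apply, smul_eq_mul]
  rw [← mul_assoc, ← Real.exp_add]
  congr 2
  linear_combination lam * hpq

lemma poisMean_sub_smul {ι : Type*} [Fintype ι] (X : Module.End ℝ (ι → ℝ)) (lam c : ℝ)
    (u e : ι → ℝ) (s : ι) : poisMean lam (fun m => (X ^ m) (u - c • e) s) =
      poisMean lam (fun m => (X ^ m) u s) - c * poisMean lam (fun m => (X ^ m) e s) := by
  rw [poisMean_pow_end, poisMean_pow_end, poisMean_pow_end, map_sub, map_smul]
  simp only [Pi.sub_apply, Pi.smul_apply, smul_eq_mul]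
  ring

/-- Near superadditivity for a Poisson number of clauses. -/
lemma poisMean_meanLog_add_le {k : ℕ} {μ : CT k → ℝ} (hμ : IsPMF μ) (h2 : H2 k μ) {n₁ n₂ : ℕ}
    (h₁ : 0 < n₁) (h₂ : 0 < n₂) {β : ℝ} (hβ : 0 ≤ β) :
    poisMean (β * n₁) (meanLog μ n₁) - (n₂ + 1) * Real.log 2 * poisMean (β * n₁) (unsatProb μ n₁) +
      (poisMean (β * n₂) (meanLog μ n₂) -
        (n₁ + 1) * Real.log 2 * poisMean (β * n₂) (unsatProb μ n₂)) ≤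
      poisMean (β * (n₁ + n₂ : ℕ)) (meanLog μ (n₁ + n₂)) + 2 * Real.log 2 := by
  have hn : ((n₁ + n₂ : ℕ) : ℝ) ≠ 0 := by positivity
  set p : ℝ := (n₁ : ℝ) / (n₁ + n₂ : ℕ) with hp
  set q : ℝ := (n₂ : ℝ) / (n₁ + n₂ : ℕ) with hq
  have hpq : p + q = 1 := by
    rw [hp, hq, ← add_div]; push_cast; exact div_self (by positivity)
  set lam : ℝ := β * (n₁ + n₂ : ℕ) with hlam
  have hlam0 : 0 ≤ lam := by positivity
  have e1 : β * n₁ = p * lam := by rw [hp, hlam]; field_simp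
  have e2 : β * n₂ = q * lam := by rw [hq, hlam]; field_simp
  rw [e1, e2]
  unfold unsatProb
  have m1 := poisMean_sub_smul (addClause μ (unif n₁)) (p * lam) ((n₂ + 1) * Real.log 2)
    logCard emptyInd Finset.univ
  have m2 := poisMean_sub_smul (addClause μ (unif n₂)) (q * lam) ((n₁ + 1) * Real.log 2)
    logCard emptyInd Finset.univ
  rw [← poisMean_thin _ lam p q hpq] at m1
  rw [← poisMean_thin _ lam q p (by rw [add_comm]; exact hpq)] at m2
  unfold meanLog at *
  rw [← m1, ← m2]
  have s1 := summable_poisWeight_pow_end (thin p q (addClause μ (unif n₁))) lam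
    (logCard - ((n₂ + 1) * Real.log 2) • emptyInd) Finset.univ
  have s2 := summable_poisWeight_pow_end (thin q p (addClause μ (unif n₂))) lam
    (logCard - ((n₁ + 1) * Real.log 2) • emptyInd) Finset.univ
  have s3 := summable_poisWeight_pow_end (addClause μ (unif (n₁ + n₂))) lam logCard Finset.univ
  have s4 := (hasSum_poisWeight lam).summable.mul_right (2 * Real.log 2)
  have e3 := poisMean_const lam (2 * Real.log 2)
  rw [← e3]
  unfold poisMean
  rw [← s1.tsum_add s2, ← s3.tsum_add s4]
  refine (s1.add s2).tsum_le_tsum (fun m => ?_) (s3.add s4)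
  rw [← mul_add, ← mul_add]
  exact mul_le_mul_of_nonneg_left (split_le_meanLog hμ h2 h₁ h₂ hp hq m)
    (poisWeight_nonneg hlam0 m)

/-- Second centred moment of the Poisson law. -/
lemma hasSum_poisWeight_sq (lam : ℝ) :
    HasSum (fun m => poisWeight lam m * ((m : ℝ) - lam) ^ 2) lam := by
  have h0 := hasSum_poisWeight lam
  have h1 : HasSum (fun m => poisWeight lam m * m) lam := by
    rw [← hasSum_nat_add_iff' 1]
    have e : lam - ∑ i ∈ Finset.range 1, poisWeight lam i * i = lam * 1 := by simp
    rw [e]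
    refine (h0.mul_left lam).congr_fun fun m => ?_
    unfold poisWeight
    rw [Nat.factorial_succ]
    push_cast
    field_simp
    ring
  have h2 : HasSum (fun m => poisWeight lam m * (m * (m - 1))) (lam ^ 2) := by
    rw [← hasSum_nat_add_iff' 2]
    have e : lam ^ 2 - ∑ i ∈ Finset.range 2, poisWeight lam i * (i * (i - 1)) = lam ^ 2 * 1 := by
      simp [Finset.sum_range_succ]
    rw [e]
    refine (h0.mul_left (lam ^ 2)).congr_fun fun m => ?_
    unfold poisWeight
    rw [Nat.factorial_succ, Nat.factorial_succ]
    push_cast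
    field_simp
    ring
  convert (h2.add (h1.mul_left (1 - 2 * lam))).add (h0.mul_left (lam ^ 2)) using 1
  · ext m; ring
  · ring

/-- The probability that a Poisson variable satisfies `P`. -/
def poisProb (lam : ℝ) (P : ℕ → Prop) : ℝ := poisMean lam fun m => if P m then 1 else 0

lemma abs_ite_le_one (P : Prop) : |(if P then (1 : ℝ) else 0)| ≤ 1 := by
  split_ifs <;> simp

/-- Chebyshev's inequality for the Poisson law. -/
lemma poisProb_le {lam t : ℝ} (h : 0 ≤ lam) (ht : 0 < t) (P : ℕ → Prop)
    (hP : ∀ m, P m → t ≤ |(m : ℝ) - lam|) : poisProb lam P ≤ lam / t ^ 2 := by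
  have h1 := (hasSum_poisWeight_sq lam).div_const (t ^ 2)
  rw [← h1.tsum_eq]
  refine Summable.tsum_le_tsum (fun m => ?_)
    (summable_poisWeight_mul h fun m => abs_ite_le_one (P m)) h1.summable
  rw [mul_div_assoc]
  refine mul_le_mul_of_nonneg_left ?_ (poisWeight_nonneg h m)
  by_cases hm : P m
  · simp only [hm, if_true]
    rw [le_div_iff₀ (by positivity), one_mul, ← sq_abs ((m : ℝ) - lam)]
    exact pow_le_pow_left₀ ht.le (hP m hm) 2
  · simp only [hm, if_false]
    positivity

lemma poisProb_add_compl {lam : ℝ} (h : 0 ≤ lam) (P : ℕ → Prop) :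
    poisProb lam P + poisProb lam (fun m => ¬ P m) = 1 := by
  have s1 := summable_poisWeight_mul h fun m => abs_ite_le_one (P m)
  have s2 := summable_poisWeight_mul h fun m => abs_ite_le_one (¬ P m)
  unfold poisProb poisMean
  rw [← s1.tsum_add s2]
  refine Eq.trans ?_ (hasSum_poisWeight lam).tsum_eq
  refine tsum_congr fun m => ?_
  by_cases hm : P m <;> simp only [hm, not_true, not_false_eq_true, if_true, if_false] <;> ring

lemma poisProb_le_eq_sum (lam : ℝ) (L : ℕ) :
    poisProb lam (fun m => m ≤ L) = ∑ m ∈ Finset.range (L + 1), poisWeight lam m := by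
  unfold poisProb poisMean
  rw [tsum_eq_sum (s := Finset.range (L + 1))]
  · refine Finset.sum_congr rfl fun m hm => ?_
    rw [Finset.mem_range] at hm
    have : m ≤ L := by omega
    simp only [this, if_true, mul_one]
  · intro m hm
    rw [Finset.mem_range] at hm
    have : ¬ m ≤ L := by omega
    simp only [this, if_false, mul_zero]

lemma continuous_poisMean {a : ℕ → ℝ} {C : ℝ} (ha : ∀ m, |a m| ≤ C) :
    Continuous fun lam => poisMean lam a := by
  have : (fun lam => poisMean lam a) =
      fun lam => Real.exp (-lam) * ∑' m, lam ^ m / m.factorial * a m := by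
    ext lam
    unfold poisMean poisWeight
    simp only [mul_assoc, tsum_mul_left]
  rw [this]
  refine (Real.continuous_exp.comp continuous_neg).mul ?_
  rw [continuous_iff_continuousAt]
  intro x
  have hC : 0 ≤ C := (abs_nonneg _).trans (ha 0)
  have hcont : ContinuousOn (fun lam : ℝ => ∑' m : ℕ, lam ^ m / m.factorial * a m)
      (Metric.ball 0 (|x| + 1)) := by
    refine continuousOn_tsum (u := fun m : ℕ => (|x| + 1) ^ m / m.factorial * C) ?_ ?_ ?_
    · intro m
      fun_prop
    · exact (hasSum_pow_div_factorial _).summable.mul_right C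
    · intro m y hy
      rw [Metric.mem_ball, dist_zero_right] at hy
      rw [norm_mul, norm_div, norm_pow]
      have hf : ‖(m.factorial : ℝ)‖ = m.factorial := Real.norm_of_nonneg (by positivity)
      rw [hf]
      have := ha m
      gcongr
      exact this
  exact hcont.continuousAt (Metric.isOpen_ball.mem_nhds (by simp))

/-- The Poisson law gives a uniformly positive mass to the values not above its mean. -/
lemma le_poisProb_le_floor {lam : ℝ} (h : 0 ≤ lam) :
    Real.exp (-4) / 4 ≤ poisProb lam (fun m => m ≤ ⌊lam⌋₊) := by
  have hP := poisProb_le_eq_sum lam ⌊lam⌋₊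
  rcases lt_or_ge lam 4 with h4 | h4
  · rw [hP]
    calc Real.exp (-4) / 4 ≤ Real.exp (-4) := by linarith [Real.exp_pos (-4)]
      _ ≤ Real.exp (-lam) := Real.exp_le_exp.mpr (by linarith)
      _ = poisWeight lam 0 := by simp [poisWeight]
      _ ≤ _ := Finset.single_le_sum (f := poisWeight lam) (fun m _ => poisWeight_nonneg h m) (by simp)
  set s := Real.sqrt lam with hs
  have hs2 : s ^ 2 = lam := Real.sq_sqrt h
  have hs2' : 2 ≤ s := by
    rw [hs]; exact Real.le_sqrt_of_sq_le (by linarith)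
  set lam' := lam - 2 * s with hlam'
  have h' : 0 ≤ lam' := by rw [hlam', ← hs2]; nlinarith
  have hpos : 0 < lam := by linarith
  have hQ : 3 / 4 ≤ ∑ m ∈ Finset.range (⌊lam⌋₊ + 1), poisWeight lam' m := by
    have c1 := poisProb_add_compl h' (fun m => m ≤ ⌊lam⌋₊)
    have c2 := poisProb_le (t := 2 * s) h' (by linarith) (fun m => ¬ m ≤ ⌊lam⌋₊) (by
      intro m hm
      have := Nat.lt_of_floor_lt (not_le.mp hm)
      rw [hlam']
      refine le_trans ?_ (le_abs_self _)
      linarith)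
    have c3 : lam' / (2 * s) ^ 2 ≤ 1 / 4 := by
      rw [mul_pow, hs2, div_le_div_iff₀ (by positivity) (by norm_num), hlam']
      linarith
    have c4 := poisProb_le_eq_sum lam' ⌊lam⌋₊
    linarith
  have hCS : (∑ m ∈ Finset.range (⌊lam⌋₊ + 1), poisWeight lam' m) ^ 2 ≤
      (∑ m ∈ Finset.range (⌊lam⌋₊ + 1), poisWeight lam m) *
        ∑ m ∈ Finset.range (⌊lam⌋₊ + 1),
          Real.exp (lam - 2 * lam') * ((lam' ^ 2 / lam) ^ m / m.factorial) := by
    refine Finset.sum_sq_le_sum_mul_sum_of_sq_le_mul _ (fun m _ => poisWeight_nonneg h m)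
      (fun m _ => by positivity) fun m _ => le_of_eq ?_
    have e1 : Real.exp (lam - 2 * lam') = Real.exp (-lam') ^ 2 / Real.exp (-lam) := by
      rw [← Real.exp_nat_mul, ← Real.exp_sub]
      congr 1
      push_cast
      ring
    rw [e1]
    unfold poisWeight
    have := Real.exp_pos (-lam)
    rw [div_pow, ← pow_mul, mul_comm 2 m, pow_mul]
    field_simp
  have hG : ∑ m ∈ Finset.range (⌊lam⌋₊ + 1),
      Real.exp (lam - 2 * lam') * ((lam' ^ 2 / lam) ^ m / m.factorial) ≤ Real.exp 4 := by
    have h1 := (hasSum_pow_div_factorial (lam' ^ 2 / lam)).mul_left (Real.exp (lam - 2 * lam'))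
    rw [← Real.exp_add] at h1
    have h2 : lam - 2 * lam' + lam' ^ 2 / lam = 4 := by
      rw [hlam', ← hs2]
      have : s ≠ 0 := by linarith
      field_simp
      ring
    rw [h2] at h1
    exact sum_le_hasSum _ (fun m _ => by positivity) h1
  rw [hP]
  set A := ∑ m ∈ Finset.range (⌊lam⌋₊ + 1), poisWeight lam m
  have hA : 0 ≤ A := Finset.sum_nonneg fun m _ => poisWeight_nonneg h m
  have h5 : 1 / 4 ≤ A * Real.exp 4 :=
    calc (1 : ℝ) / 4 ≤ (∑ m ∈ Finset.range (⌊lam⌋₊ + 1), poisWeight lam' m) ^ 2 := by nlinarith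
      _ ≤ _ := hCS
      _ ≤ _ := mul_le_mul_of_nonneg_left hG hA
  rw [Real.exp_neg, div_le_iff₀ (by norm_num), inv_le_iff_one_le_mul₀ (Real.exp_pos 4)]
  linarith

lemma pow_addClause_const {k : ℕ} {V : Type*} [Fintype V] {μ : CT k → ℝ} {w : V → ℝ}
    (hμ : IsPMF μ) (hw : IsPMF w) (m : ℕ) (C : ℝ) :
    (addClause μ w ^ m) (fun _ => C) = fun _ => C := by
  induction m with
  | zero => simp
  | succ m ih =>
    rw [pow_succ', Module.End.mul_apply, ih]
    ext S
    rw [addClause_apply, ← Finset.sum_mul, (clauseWeight_isPMF hμ hw).2, one_mul]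

lemma pow_addClause_mem_Icc {k : ℕ} {V : Type*} [Fintype V] {μ : CT k → ℝ} {w : V → ℝ}
    (hμ : IsPMF μ) (hw : IsPMF w) (m : ℕ) {F : Finset (V → Bool) → ℝ} {C : ℝ} (h0 : ∀ S, 0 ≤ F S)
    (hC : ∀ S, F S ≤ C) (S : Finset (V → Bool)) :
    0 ≤ (addClause μ w ^ m) F S ∧ (addClause μ w ^ m) F S ≤ C := by
  have hm := monotone_pow_end (addClause_monotone hμ hw) m
  have h1 := hm (show (fun _ => (0 : ℝ)) ≤ F from h0) S
  have h2 := hm (show F ≤ (fun _ => C) from hC) S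
  rw [pow_addClause_const hμ hw] at h1 h2
  exact ⟨h1, h2⟩

lemma meanLog_nonneg {k : ℕ} {μ : CT k → ℝ} (hμ : IsPMF μ) {n : ℕ} (hn : 0 < n) (m : ℕ) :
    0 ≤ meanLog μ n m :=
  (pow_addClause_mem_Icc hμ (unif_isPMF hn) m logCard_nonneg log_one_add_card_le _).1

lemma meanLog_le {k : ℕ} {μ : CT k → ℝ} (hμ : IsPMF μ) {n : ℕ} (hn : 0 < n) (m : ℕ) :
    meanLog μ n m ≤ (n + 1) * Real.log 2 :=
  (pow_addClause_mem_Icc hμ (unif_isPMF hn) m logCard_nonneg log_one_add_card_le _).2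

lemma abs_meanLog_le {k : ℕ} {μ : CT k → ℝ} (hμ : IsPMF μ) {n : ℕ} (hn : 0 < n) (m : ℕ) :
    |meanLog μ n m| ≤ (n + 1) * Real.log 2 := by
  rw [abs_of_nonneg (meanLog_nonneg hμ hn m)]
  exact meanLog_le hμ hn m

lemma emptyInd_mem_Icc {V : Type*} (S : Finset (V → Bool)) : 0 ≤ emptyInd S ∧ emptyInd S ≤ 1 := by
  unfold emptyInd
  split_ifs <;> norm_num

lemma unsatProb_nonneg {k : ℕ} {μ : CT k → ℝ} (hμ : IsPMF μ) {n : ℕ} (hn : 0 < n) (m : ℕ) :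
    0 ≤ unsatProb μ n m :=
  (pow_addClause_mem_Icc hμ (unif_isPMF hn) m (fun S => (emptyInd_mem_Icc S).1)
    (fun S => (emptyInd_mem_Icc S).2) _).1

lemma unsatProb_le_one {k : ℕ} {μ : CT k → ℝ} (hμ : IsPMF μ) {n : ℕ} (hn : 0 < n) (m : ℕ) :
    unsatProb μ n m ≤ 1 :=
  (pow_addClause_mem_Icc hμ (unif_isPMF hn) m (fun S => (emptyInd_mem_Icc S).1)
    (fun S => (emptyInd_mem_Icc S).2) _).2

lemma abs_unsatProb_le {k : ℕ} {μ : CT k → ℝ} (hμ : IsPMF μ) {n : ℕ} (hn : 0 < n) (m : ℕ) :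
    |unsatProb μ n m| ≤ 1 := by
  rw [abs_of_nonneg (unsatProb_nonneg hμ hn m)]
  exact unsatProb_le_one hμ hn m

lemma meanLog_antitone {k : ℕ} {μ : CT k → ℝ} (hμ : IsPMF μ) {n : ℕ} (hn : 0 < n) :
    Antitone (meanLog μ n) := by
  refine antitone_nat_of_succ_le fun m => ?_
  unfold meanLog
  rw [pow_succ, Module.End.mul_apply]
  refine monotone_pow_end (addClause_monotone hμ (unif_isPMF hn)) m (fun S => ?_) _
  have hc := clauseWeight_isPMF hμ (unif_isPMF hn)
  rw [addClause_apply]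
  calc _ ≤ ∑ c, clauseWeight μ (unif n) c * logCard S := by
        refine Finset.sum_le_sum fun c _ => mul_le_mul_of_nonneg_left ?_ (hc.1 c)
        have : ((S ∩ satSet c).card : ℝ) ≤ S.card := by
          exact_mod_cast Finset.card_le_card Finset.inter_subset_left
        exact Real.log_le_log (by positivity) (by linarith)
    _ = logCard S := by rw [← Finset.sum_mul, hc.2, one_mul]

lemma unsatProb_monotone {k : ℕ} {μ : CT k → ℝ} (hμ : IsPMF μ) {n : ℕ} (hn : 0 < n) :
    Monotone (unsatProb μ n) := by
  refine monotone_nat_of_le_succ fun m => ?_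
  unfold unsatProb
  rw [pow_succ, Module.End.mul_apply]
  refine monotone_pow_end (addClause_monotone hμ (unif_isPMF hn)) m (fun S => ?_) _
  have hc := clauseWeight_isPMF hμ (unif_isPMF hn)
  rw [addClause_apply]
  calc emptyInd S = ∑ c, clauseWeight μ (unif n) c * emptyInd S := by
        rw [← Finset.sum_mul, hc.2, one_mul]
    _ ≤ _ := by
        refine Finset.sum_le_sum fun c _ => mul_le_mul_of_nonneg_left ?_ (hc.1 c)
        by_cases hS : S = ∅
        · simp [hS]
        · refine le_trans (le_of_eq ?_) (emptyInd_mem_Icc _).1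
          simp [emptyInd, hS]

/-- The expectation over a formula with `m` clauses as a power of the Markov operator. -/
lemma sum_wG_mul {k n m : ℕ} (μ : CT k → ℝ) (G : Finset (Fin n → Bool) → ℝ)
    (S : Finset (Fin n → Bool)) :
    ∑ f : Fin m → ClauseG n k, wG μ f * G (S.filter fun x => ∀ a, satC x (f a)) =
      (addClause μ (unif n) ^ m) G S := by
  induction m generalizing S with
  | zero => simp [wG]
  | succ m ih =>
    rw [pow_succ', Module.End.mul_apply, addClause_apply,
      ← (Fin.consEquiv fun _ : Fin (m + 1) => ClauseG n k).sum_comp, Fintype.sum_prod_type]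
    refine Finset.sum_congr rfl fun c _ => ?_
    rw [← ih, Finset.mul_sum]
    refine Finset.sum_congr rfl fun f _ => ?_
    have h1 : wG μ ((Fin.consEquiv fun _ : Fin (m + 1) => ClauseG n k) (c, f)) =
        clauseWeight μ (unif n) c * wG μ f := by
      simp [wG, Fin.consEquiv, Fin.prod_univ_succ, clauseWeight, unif]
    have h2 : (S.filter fun x => ∀ a, satC x
        ((Fin.consEquiv fun _ : Fin (m + 1) => ClauseG n k) (c, f) a)) =
        (S ∩ satSet c).filter fun x => ∀ a, satC x (f a) := by
      ext x
      rw [Finset.mem_filter, Finset.mem_filter, Finset.mem_inter, and_assoc]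
      simp [Fin.consEquiv, Fin.forall_fin_succ, satSet, satC]
    rw [h1, h2, mul_assoc]

lemma wG_nonneg {k n m : ℕ} {μ : CT k → ℝ} (hμ : IsPMF μ) (f : Fin m → ClauseG n k) :
    0 ≤ wG μ f :=
  Finset.prod_nonneg fun a _ => mul_nonneg (by positivity) (hμ.1 _)

lemma sum_wG_mul_ZC {k n m : ℕ} (μ : CT k → ℝ) (g : ℕ → ℝ) :
    ∑ f : Fin m → ClauseG n k, wG μ f * g (ZC f) =
      (addClause μ (unif n) ^ m) (fun S => g S.card) Finset.univ := by
  rw [← sum_wG_mul]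
  rfl

lemma emptyInd_eq {V : Type*} :
    (emptyInd : Finset (V → Bool) → ℝ) = fun S => if S.card = 0 then 1 else 0 := by
  ext S
  simp [emptyInd]

lemma PnG_zero_eq (k n : ℕ) (α : ℝ) (μ : CT k → ℝ) :
    PnG k n α 0 μ = unsatProb μ n ⌊α * (n : ℝ)⌋₊ := by
  unfold PnG unsatProb
  rw [emptyInd_eq, ← sum_wG_mul_ZC μ fun z => if z = 0 then 1 else 0]
  refine Finset.sum_congr rfl fun f _ => ?_
  rw [mul_zero, Real.rpow_zero]
  by_cases h : ZC f = 0
  · simp [h]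
  · have : ¬ ((ZC f : ℝ) < 1) := by
      rw [not_lt]; exact_mod_cast Nat.one_le_iff_ne_zero.mpr h
    simp [h, this]

lemma psinG_bounds {k n : ℕ} {μ : CT k → ℝ} (hμ : IsPMF μ) (hn : 0 < n) (α : ℝ)
    (hu : unsatProb μ n ⌊α * (n : ℝ)⌋₊ < 1) :
    1 / (n : ℝ) * ((meanLog μ n ⌊α * (n : ℝ)⌋₊ - Real.log 2) /
        (1 - unsatProb μ n ⌊α * (n : ℝ)⌋₊)) ≤ psinG k n α μ ∧
      psinG k n α μ ≤ 1 / (n : ℝ) * (meanLog μ n ⌊α * (n : ℝ)⌋₊ /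
        (1 - unsatProb μ n ⌊α * (n : ℝ)⌋₊)) := by
  set m := ⌊α * (n : ℝ)⌋₊ with hm
  have hl : 0 < Real.log 2 := Real.log_pos (by norm_num)
  have htot : ∑ f : Fin m → ClauseG n k, wG μ f = 1 := by
    have := sum_wG_mul_ZC (n := n) (m := m) μ fun _ => 1
    rw [pow_addClause_const hμ (unif_isPMF hn)] at this
    simpa using this
  have hden : (∑ f : Fin m → ClauseG n k, if 1 ≤ ZC f then wG μ f else 0) =
      1 - unsatProb μ n m := by
    unfold unsatProb
    rw [emptyInd_eq, ← sum_wG_mul_ZC μ fun z => if z = 0 then 1 else 0]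
    refine Eq.trans ?_ (congrArg (· - _) htot)
    rw [← Finset.sum_sub_distrib]
    refine Finset.sum_congr rfl fun f _ => ?_
    by_cases h : ZC f = 0
    · simp [h]
    · simp [h, Nat.one_le_iff_ne_zero]
  have hmean : meanLog μ n m = ∑ f : Fin m → ClauseG n k, wG μ f * Real.log (1 + ZC f) := by
    rw [sum_wG_mul_ZC μ fun z => Real.log (1 + z)]
    rfl
  have hnum₁ : meanLog μ n m - Real.log 2 ≤
      ∑ f : Fin m → ClauseG n k, if 1 ≤ ZC f then wG μ f * Real.log (ZC f) else 0 := by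
    have : Real.log 2 = ∑ f : Fin m → ClauseG n k, wG μ f * Real.log 2 := by
      rw [← Finset.sum_mul, htot, one_mul]
    rw [hmean, this, ← Finset.sum_sub_distrib]
    refine Finset.sum_le_sum fun f _ => ?_
    by_cases h : 1 ≤ ZC f
    · have h' : (1 : ℝ) ≤ ZC f := by exact_mod_cast h
      simp only [h, if_true]
      rw [← mul_sub]
      refine mul_le_mul_of_nonneg_left ?_ (wG_nonneg hμ f)
      rw [sub_le_iff_le_add, ← Real.log_mul (by positivity) (by norm_num)]
      exact Real.log_le_log (by positivity) (by linarith)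
    · have h' : ZC f = 0 := by omega
      simp only [h']
      have := mul_nonneg (wG_nonneg hμ f) hl.le
      simpa using this
  have hnum₂ : (∑ f : Fin m → ClauseG n k, if 1 ≤ ZC f then wG μ f * Real.log (ZC f) else 0) ≤
      meanLog μ n m := by
    rw [hmean]
    refine Finset.sum_le_sum fun f _ => ?_
    split_ifs with h
    · have h' : (1 : ℝ) ≤ ZC f := by exact_mod_cast h
      exact mul_le_mul_of_nonneg_left (Real.log_le_log (by positivity) (by linarith))
        (wG_nonneg hμ f)
    · have h' : (0 : ℝ) ≤ ZC f := by positivity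
      exact mul_nonneg (wG_nonneg hμ f) (Real.log_nonneg (by linarith))
  have hpos : 0 < 1 - unsatProb μ n m := by linarith
  unfold psinG
  rw [← hm, hden]
  constructor
  · gcongr
  · gcongr

/-- The error in the comparison of `b N / N` with the limit of a nearly superadditive sequence. -/
def superErr (c : ℝ) (g : ℕ → ℝ) (N : ℕ) : ℝ :=
  4 * c / N + 3 * c * ∑' l, g (l + (Nat.log 2 N - 1))

lemma tendsto_log_two_atTop : Tendsto (Nat.log 2) atTop atTop := by
  refine tendsto_atTop_mono' atTop (f₁ := Nat.log 2) (Eventually.of_forall fun n => le_rfl) ?_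
  refine tendsto_atTop.mpr fun j => ?_
  filter_upwards [eventually_ge_atTop (2 ^ j)] with n hn
  calc j = Nat.log 2 (2 ^ j) := (Nat.log_pow (by norm_num) j).symm
    _ ≤ Nat.log 2 n := Nat.log_mono_right hn

lemma tendsto_superErr (c : ℝ) (g : ℕ → ℝ) : Tendsto (superErr c g) atTop (𝓝 0) := by
  have h1 : Tendsto (fun N : ℕ => 4 * c / (N : ℝ)) atTop (𝓝 0) :=
    tendsto_const_div_atTop_nhds_zero_nat _
  have h2 : Tendsto (fun N : ℕ => Nat.log 2 N - 1) atTop atTop :=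
    (tendsto_sub_atTop_nat 1).comp tendsto_log_two_atTop
  have h3 := ((tendsto_sum_nat_add g).comp h2).const_mul (3 * c)
  have h4 := h1.add h3
  rw [mul_zero, add_zero] at h4
  exact h4

lemma superadd_mul {b g : ℕ → ℝ} {c : ℝ} (hc : 0 ≤ c) (hg : Antitone g) (hg0 : ∀ j, 0 ≤ g j)
    (H : ∀ n₁ n₂ : ℕ, 1 ≤ n₁ → 1 ≤ n₂ → b n₁ + b n₂ ≤ b (n₁ + n₂) + 2 * c +
      (n₂ + 1) * c * g (Nat.log 2 n₁) + (n₁ + 1) * c * g (Nat.log 2 n₂))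
    {N i : ℕ} (hN : 2 ^ i ≤ N) (j q : ℕ) (hq1 : 1 ≤ q) (hq : q ≤ 2 ^ j) :
    q * b N - q * ∑ l ∈ Finset.range j, (2 * c / 2 ^ l + (N + 2) * c * g (i + l - 1)) ≤
      b (q * N) := by
  induction j generalizing q with
  | zero =>
    have : q = 1 := by simp at hq; omega
    simp [this]
  | succ j ih =>
    set s := ∑ l ∈ Finset.range j, (2 * c / 2 ^ l + (N + 2) * c * g (i + l - 1)) with hs
    rw [Finset.sum_range_succ, ← hs]
    have hd : 0 ≤ 2 * c / 2 ^ j + (N + 2) * c * g (i + j - 1) := by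
      have := hg0 (i + j - 1)
      positivity
    by_cases hqj : q ≤ 2 ^ j
    · have := ih q hq1 hqj
      have hq0 : (0 : ℝ) ≤ q := by positivity
      nlinarith
    · have hN1 : 1 ≤ N := le_trans Nat.one_le_two_pow hN
      have h2j : 1 ≤ 2 ^ j := Nat.one_le_two_pow
      have hpow : 2 ^ (j + 1) = 2 * 2 ^ j := by ring
      obtain ⟨q₁, q₂, rfl, h1, h12, h22⟩ : ∃ q₁ q₂, q = q₁ + q₂ ∧ 2 ^ j ≤ 2 * q₁ ∧ q₁ ≤ q₂ ∧
          q₂ ≤ 2 ^ j := ⟨q / 2, q - q / 2, by omega, by omega, by omega, by omega⟩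
      have hlog : ∀ r, q₁ ≤ r → i + j - 1 ≤ Nat.log 2 (r * N) := by
        intro r hr
        have : i + j ≤ Nat.log 2 (r * N * 2) := by
          rw [← Nat.log_pow (b := 2) (by norm_num) (i + j)]
          refine Nat.log_mono_right ?_
          rw [pow_add]
          nlinarith
        rw [Nat.log_mul_base (by norm_num) (Nat.mul_ne_zero (by omega) (by omega))] at this
        omega
      have e1 := ih q₁ (by omega) (by omega)
      have e2 := ih q₂ (by omega) (by omega)
      have e3 := H (q₁ * N) (q₂ * N) (by nlinarith) (by nlinarith)
      have g1 := hg (hlog q₁ le_rfl)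
      have g2 := hg (hlog q₂ h12)
      set G := g (i + j - 1)
      have hG : 0 ≤ G := hg0 _
      rw [add_mul q₁ q₂ N]
      push_cast at e3 ⊢
      have e4 : ((q₂ : ℝ) * N + 1) * c * g (Nat.log 2 (q₁ * N)) ≤ (q₂ * N + 1) * c * G :=
        mul_le_mul_of_nonneg_left g1 (by positivity)
      have e5 : ((q₁ : ℝ) * N + 1) * c * g (Nat.log 2 (q₂ * N)) ≤ (q₁ * N + 1) * c * G :=
        mul_le_mul_of_nonneg_left g2 (by positivity)
      have hQ : (2 : ℝ) ^ j ≤ q₁ + q₂ := by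
        have : 2 ^ j ≤ q₁ + q₂ := by omega
        exact_mod_cast this
      have hQ1 : (1 : ℝ) ≤ q₁ + q₂ := le_trans (one_le_pow₀ (by norm_num)) hQ
      have e6 : 2 * c ≤ (q₁ + q₂) * (2 * c / 2 ^ j) := by
        rw [← mul_div_assoc, le_div_iff₀ (by positivity), mul_comm]
        exact mul_le_mul_of_nonneg_right hQ (by positivity)
      have e7 : 2 * (c * G) ≤ 2 * (c * G) * (q₁ + q₂) :=
        le_mul_of_one_le_right (by positivity) hQ1
      linarith

lemma superadd_mul_ge {b g : ℕ → ℝ} {c : ℝ} (hc : 0 ≤ c) (hg : Antitone g) (hg0 : ∀ j, 0 ≤ g j)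
    (hgs : Summable g)
    (H : ∀ n₁ n₂ : ℕ, 1 ≤ n₁ → 1 ≤ n₂ → b n₁ + b n₂ ≤ b (n₁ + n₂) + 2 * c +
      (n₂ + 1) * c * g (Nat.log 2 n₁) + (n₁ + 1) * c * g (Nat.log 2 n₂))
    {N q : ℕ} (hN : 2 ≤ N) (hq : 1 ≤ q) :
    (q * N : ℝ) * (b N / N - superErr c g N) ≤ b (q * N) := by
  have h1 := superadd_mul hc hg hg0 H (Nat.pow_log_le_self 2 (by omega : N ≠ 0)) q q hq
    Nat.lt_two_pow_self.le
  set i := Nat.log 2 N with hi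
  have hi1 : 1 ≤ i := Nat.log_pos (by norm_num) hN
  have hsum : ∑ l ∈ Finset.range q, (2 * c / 2 ^ l + (N + 2) * c * g (i + l - 1)) ≤
      N * superErr c g N := by
    rw [Finset.sum_add_distrib, ← Finset.mul_sum]
    have s1 : ∑ l ∈ Finset.range q, 2 * c / (2 : ℝ) ^ l ≤ 4 * c := by
      have e : ∀ l ∈ Finset.range q, 2 * c / (2 : ℝ) ^ l = 2 * c * (1 / 2) ^ l := fun l _ => by
        rw [one_div, inv_pow, div_eq_mul_inv]
      rw [Finset.sum_congr rfl e, ← Finset.mul_sum]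
      have := sum_geometric_two_le q
      nlinarith
    have s2 : ∑ l ∈ Finset.range q, g (i + l - 1) ≤ ∑' l, g (l + (i - 1)) := by
      have e : ∀ l ∈ Finset.range q, g (i + l - 1) = g (l + (i - 1)) := fun l _ => by
        congr 1; omega
      rw [Finset.sum_congr rfl e]
      exact ((summable_nat_add_iff (i - 1)).mpr hgs).sum_le_tsum _ fun l _ => hg0 _
    have s3 : 0 ≤ ∑' l, g (l + (i - 1)) := tsum_nonneg fun l => hg0 _
    have hN' : (2 : ℝ) ≤ N := by exact_mod_cast hN
    unfold superErr
    rw [← hi, mul_add, mul_div_cancel₀ _ (by positivity)]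
    refine add_le_add s1 ?_
    calc (N + 2) * c * ∑ l ∈ Finset.range q, g (i + l - 1)
        ≤ (N + 2) * c * ∑' l, g (l + (i - 1)) := by gcongr
      _ ≤ (3 * N) * c * ∑' l, g (l + (i - 1)) := by
        gcongr
        linarith
      _ = _ := by ring
  have hq0 : (0 : ℝ) ≤ q := by positivity
  have hN0 : (N : ℝ) ≠ 0 := by positivity
  calc (q * N : ℝ) * (b N / N - superErr c g N) = q * b N - q * (N * superErr c g N) := by
        field_simp
    _ ≤ _ := by nlinarith

lemma superadd_eventually {b g : ℕ → ℝ} {c : ℝ} (hc : 0 ≤ c) (hg : Antitone g)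
    (hg0 : ∀ j, 0 ≤ g j) (hgs : Summable g) (hb : ∀ n, 1 ≤ n → 0 ≤ b n)
    (H : ∀ n₁ n₂ : ℕ, 1 ≤ n₁ → 1 ≤ n₂ → b n₁ + b n₂ ≤ b (n₁ + n₂) + 2 * c +
      (n₂ + 1) * c * g (Nat.log 2 n₁) + (n₁ + 1) * c * g (Nat.log 2 n₂))
    {N : ℕ} (hN : 2 ≤ N) {δ : ℝ} (hδ : 0 < δ) :
    ∀ᶠ n : ℕ in atTop, b N / N - superErr c g N - δ ≤ b n / n := by
  set y := b N / N - superErr c g N with hy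
  have hlim : Tendsto (fun t => c * g t) atTop (𝓝 0) := by
    simpa using hgs.tendsto_atTop_zero.const_mul c
  obtain ⟨t, ht⟩ := (hlim.eventually (gt_mem_nhds (half_pos hδ))).exists
  set R := 2 ^ t with hR
  have hR1 : 1 ≤ R := Nat.one_le_two_pow
  set A : ℝ := (R + N) * |y| + 2 * c + (R + N + 1) * c * g 0 + c * g t with hA
  have hAlim : Tendsto (fun n : ℕ => A / (n : ℝ)) atTop (𝓝 0) :=
    tendsto_const_div_atTop_nhds_zero_nat _
  filter_upwards [hAlim.eventually (gt_mem_nhds (half_pos hδ)), eventually_ge_atTop (R + N)]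
    with n hn hnR
  have hn0 : (0 : ℝ) < n := by
    have : 0 < n := by omega
    exact_mod_cast this
  obtain ⟨q, r, hqr, hq, hr, hrN⟩ : ∃ q r, n = q * N + r ∧ 1 ≤ q ∧ R ≤ r ∧ r ≤ R + N := by
    refine ⟨(n - R) / N, R + (n - R) % N, ?_, ?_, by omega, ?_⟩
    · have := Nat.div_add_mod' (n - R) N
      omega
    · rw [Nat.one_le_div_iff (by omega)]; omega
    · have := Nat.mod_lt (n - R) (show 0 < N by omega)
      omega
  have h1 := superadd_mul_ge hc hg hg0 hgs H hN hq
  have h2 := H (q * N) r (by nlinarith) (by omega)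
  have h3 := hb r (by omega)
  have h4 : g (Nat.log 2 r) ≤ g t := by
    refine hg ?_
    rw [← Nat.log_pow (b := 2) (by norm_num) t]
    exact Nat.log_mono_right hr
  have h5 : g (Nat.log 2 (q * N)) ≤ g 0 := hg (Nat.zero_le _)
  have hnr : (n : ℝ) = q * N + r := by exact_mod_cast hqr
  have hrN' : (r : ℝ) ≤ R + N := by exact_mod_cast hrN
  have hr0 : (0 : ℝ) ≤ r := by positivity
  rw [← hqr] at h2
  push_cast at h2
  have g0 := hg0 0
  have gt := hg0 t
  have h6 : ((r : ℝ) + 1) * c * g (Nat.log 2 (q * N)) ≤ (R + N + 1) * c * g 0 := by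
    calc ((r : ℝ) + 1) * c * g (Nat.log 2 (q * N)) ≤ ((r : ℝ) + 1) * c * g 0 := by gcongr
      _ ≤ _ := by gcongr
  have h7 : ((q : ℝ) * N + 1) * c * g (Nat.log 2 r) ≤ (n + 1) * c * g t := by
    calc ((q : ℝ) * N + 1) * c * g (Nat.log 2 r) ≤ ((q : ℝ) * N + 1) * c * g t := by gcongr
      _ ≤ _ := by
        gcongr
        linarith
  have h8 : n * y - (R + N) * |y| ≤ (q * N : ℝ) * y := by
    have : (r : ℝ) * y ≤ (R + N) * |y| :=
      (mul_le_mul_of_nonneg_left (le_abs_self y) hr0).trans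
        (mul_le_mul_of_nonneg_right hrN' (abs_nonneg y))
    rw [hnr]
    linarith
  have h9 : n * y - A - n * (c * g t) ≤ b n := by
    rw [hA]
    linarith
  rw [le_div_iff₀ hn0]
  rw [div_lt_iff₀ hn0] at hn
  nlinarith

/-- Convergence of a nearly superadditive sequence, with a quantitative lower bound on the limit. -/
lemma exists_tendsto_of_superadd {b g : ℕ → ℝ} {c : ℝ} (hc : 0 ≤ c) (hg : Antitone g)
    (hg0 : ∀ j, 0 ≤ g j) (hgs : Summable g) (hb : ∀ n, 1 ≤ n → 0 ≤ b n)
    (hb' : ∀ n, 1 ≤ n → b n ≤ 2 * c * n)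
    (H : ∀ n₁ n₂ : ℕ, 1 ≤ n₁ → 1 ≤ n₂ → b n₁ + b n₂ ≤ b (n₁ + n₂) + 2 * c +
      (n₂ + 1) * c * g (Nat.log 2 n₁) + (n₁ + 1) * c * g (Nat.log 2 n₂)) :
    ∃ L, Tendsto (fun n : ℕ => b n / n) atTop (𝓝 L) ∧
      ∀ N : ℕ, 2 ≤ N → b N / N - superErr c g N ≤ L := by
  set s : Set ℝ := (fun N : ℕ => b N / N - superErr c g N) '' Set.Ici 2 with hs
  have hne : s.Nonempty := ⟨_, 2, Set.mem_Ici.mpr le_rfl, rfl⟩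
  have hbdd : BddAbove s := by
    refine ⟨2 * c, ?_⟩
    rintro _ ⟨N, hN, rfl⟩
    have hN2 : 2 ≤ N := hN
    have hN0 : (0 : ℝ) < N := by
      have : 0 < N := by omega
      exact_mod_cast this
    have h1 : b N / N ≤ 2 * c := by
      rw [div_le_iff₀ hN0]
      exact hb' N (by omega)
    have h2 : 0 ≤ superErr c g N := by
      have : 0 ≤ ∑' l, g (l + (Nat.log 2 N - 1)) := tsum_nonneg fun l => hg0 _
      unfold superErr
      positivity
    show b N / N - superErr c g N ≤ 2 * c
    linarith
  have hle : ∀ N : ℕ, 2 ≤ N → b N / N - superErr c g N ≤ sSup s := fun N hN =>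
    le_csSup hbdd ⟨N, hN, rfl⟩
  refine ⟨sSup s, tendsto_order.mpr ⟨fun a ha => ?_, fun a ha => ?_⟩, hle⟩
  · obtain ⟨_, ⟨N, hN, rfl⟩, hlt⟩ := exists_lt_of_lt_csSup hne ha
    have hlt' : a < b N / N - superErr c g N := hlt
    filter_upwards [superadd_eventually hc hg hg0 hgs hb H hN
      (half_pos (sub_pos.mpr hlt'))] with n hn
    linarith
  · filter_upwards [(tendsto_superErr c g).eventually (gt_mem_nhds (sub_pos.mpr ha)),
      eventually_ge_atTop 2] with n hn hn2
    linarith [hle n hn2]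

lemma poisMean_affine {lam : ℝ} (h : 0 ≤ lam) (P Q : ℕ → Prop) (x y z : ℝ) :
    poisMean lam (fun m => x + y * (if P m then 1 else 0) + z * (if Q m then 1 else 0)) =
      x + y * poisProb lam P + z * poisProb lam Q := by
  have h1 := (hasSum_poisWeight lam).mul_right x
  have h2 := (summable_poisWeight_mul h fun m => abs_ite_le_one (P m)).hasSum.mul_left y
  have h3 := (summable_poisWeight_mul h fun m => abs_ite_le_one (Q m)).hasSum.mul_left z
  have h4 := ((h1.add h2).add h3).tsum_eq
  rw [one_mul] at h4
  refine Eq.trans ?_ h4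
  exact tsum_congr fun m => by ring

lemma abs_affine_le (p q : Prop) (x y z : ℝ) :
    |x + y * (if p then 1 else 0) + z * (if q then 1 else 0)| ≤ |x| + |y| + |z| := by
  have h1 : |y * (if p then (1 : ℝ) else 0)| ≤ |y| := by
    rw [abs_mul]; exact mul_le_of_le_one_right (abs_nonneg y) (abs_ite_le_one p)
  have h2 : |z * (if q then (1 : ℝ) else 0)| ≤ |z| := by
    rw [abs_mul]; exact mul_le_of_le_one_right (abs_nonneg z) (abs_ite_le_one q)
  exact (abs_add_three _ _ _).trans (by linarith)

lemma poisMean_le_affine {lam : ℝ} (h : 0 ≤ lam) {a : ℕ → ℝ} {C : ℝ} (ha : ∀ m, |a m| ≤ C)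
    (P Q : ℕ → Prop) (x y z : ℝ)
    (hle : ∀ m, a m ≤ x + y * (if P m then 1 else 0) + z * (if Q m then 1 else 0)) :
    poisMean lam a ≤ x + y * poisProb lam P + z * poisProb lam Q := by
  rw [← poisMean_affine h]
  exact poisMean_le h ha (fun m => abs_affine_le _ _ x y z) hle

lemma affine_le_poisMean {lam : ℝ} (h : 0 ≤ lam) {a : ℕ → ℝ} {C : ℝ} (ha : ∀ m, |a m| ≤ C)
    (P Q : ℕ → Prop) (x y z : ℝ)
    (hle : ∀ m, x + y * (if P m then 1 else 0) + z * (if Q m then 1 else 0) ≤ a m) :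
    x + y * poisProb lam P + z * poisProb lam Q ≤ poisMean lam a := by
  rw [← poisMean_affine h]
  exact poisMean_le h (fun m => abs_affine_le _ _ x y z) ha hle

/-- Large deviations of a Poisson variable of parameter `β n` are at distance of order `n`. -/
lemma poisProb_le_div {β δ : ℝ} (hβ : 0 ≤ β) (hδ : 0 < δ) {n : ℕ} (hn : 0 < n) (P : ℕ → Prop)
    (hP : ∀ m, P m → δ * n ≤ |(m : ℝ) - β * n|) :
    poisProb (β * n) P ≤ β / δ ^ 2 / n := by
  have hn' : (0 : ℝ) < n := by exact_mod_cast hn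
  refine (poisProb_le (by positivity) (by positivity) P hP).trans (le_of_eq ?_)
  field_simp

lemma poisProb_gt_floor {β β' : ℝ} (hβ : 0 ≤ β) (h : β < β') {n : ℕ} (hn : 0 < n) :
    poisProb (β * n) (fun m => ⌊β' * n⌋₊ < m) ≤ β / (β' - β) ^ 2 / n := by
  refine poisProb_le_div hβ (sub_pos.mpr h) hn _ fun m hm => ?_
  have h1 := Nat.lt_of_floor_lt hm
  have := le_abs_self ((m : ℝ) - β * n)
  linarith

lemma poisProb_lt_floor {β β' : ℝ} (hβ' : 0 ≤ β') (h : β' < β) {n : ℕ} (hn : 0 < n) :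
    poisProb (β * n) (fun m => m < ⌊β' * n⌋₊) ≤ β / (β - β') ^ 2 / n := by
  refine poisProb_le_div (hβ'.trans h.le) (sub_pos.mpr h) hn _ fun m hm => ?_
  have h1 : (m : ℝ) ≤ ⌊β' * n⌋₊ := by exact_mod_cast hm.le
  have h2 := Nat.floor_le (show 0 ≤ β' * (n : ℝ) by positivity)
  have := neg_le_abs ((m : ℝ) - β * n)
  linarith

/-- Passage from a Poisson number of clauses to a deterministic one. -/
lemma tendsto_of_poisMean {A : ℕ → ℕ → ℝ} {c : ℝ} (hc : 0 ≤ c) (hA : ∀ n, 0 < n → Antitone (A n))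
    (hA0 : ∀ n, 0 < n → ∀ m, 0 ≤ A n m) (hA1 : ∀ n, 0 < n → ∀ m, A n m ≤ 2 * c * n)
    {α α₁ : ℝ} (hα : 0 ≤ α) (hα₁ : α < α₁) {e : ℕ → ℝ} (he : Tendsto e atTop (𝓝 0)) {L : ℝ → ℝ}
    (hL : ∀ β ∈ Set.Icc α α₁, Tendsto (fun n : ℕ => poisMean (β * n) (A n) / n) atTop (𝓝 (L β)) ∧
      ∀ N : ℕ, 2 ≤ N → poisMean (β * N) (A N) / N - e N ≤ L β) :
    Tendsto (fun n : ℕ => A n ⌊α * n⌋₊ / n) atTop (𝓝 (L α)) := by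
  have habs : ∀ n, 0 < n → ∀ m, |A n m| ≤ 2 * c * n := fun n hn m => by
    rw [abs_of_nonneg (hA0 n hn m)]; exact hA1 n hn m
  have hαL := hL α ⟨le_rfl, hα₁.le⟩
  set κ : ℝ := Real.exp (-4) / 4 with hκ
  have hκ0 : 0 < κ := by positivity
  suffices key : ∀ δ : ℝ, 0 < δ → ∀ᶠ n : ℕ in atTop,
      L α - 3 * δ ≤ A n ⌊α * n⌋₊ / n ∧ A n ⌊α * n⌋₊ / n ≤ L α + (2 + 5 / κ) * δ by
    have hK : 0 < 2 + 5 / κ := by positivity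
    refine tendsto_order.mpr ⟨fun a ha => ?_, fun a ha => ?_⟩
    · filter_upwards [key ((L α - a) / 4) (by linarith)] with n hn
      linarith [hn.1]
    · have hd : 0 < (a - L α) / (2 * (2 + 5 / κ)) := div_pos (by linarith) (by positivity)
      filter_upwards [key _ hd] with n hn
      have : (2 + 5 / κ) * ((a - L α) / (2 * (2 + 5 / κ))) = (a - L α) / 2 := by
        field_simp
      linarith [hn.2]
  intro δ hδ
  obtain ⟨N, hN1, hN2, hN3⟩ : ∃ N : ℕ, L α - δ < poisMean (α * N) (A N) / N ∧ e N < δ ∧ 2 ≤ N :=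
    ((hαL.1.eventually (lt_mem_nhds (by linarith))).and
      ((he.eventually (gt_mem_nhds hδ)).and (eventually_ge_atTop 2))).exists
  have hcont : Continuous fun β : ℝ => poisMean (β * N) (A N) / N - e N :=
    (((continuous_poisMean (habs N (by omega))).comp
      (continuous_id.mul continuous_const)).div_const _).sub continuous_const
  have hnhds : ∀ᶠ β in 𝓝[>] α, L α - 2 * δ < poisMean (β * N) (A N) / N - e N :=
    (hcont.tendsto α).mono_left nhdsWithin_le_nhds |>.eventually (lt_mem_nhds (by linarith))
  obtain ⟨γ, hγ, hγ1⟩ := (hnhds.and (Ioo_mem_nhdsGT hα₁)).exists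
  have hγL := hL γ ⟨hγ1.1.le, hγ1.2.le⟩
  have hLγ : L α - 2 * δ < L γ := hγ.trans_le (hγL.2 N hN3)
  set β := (α + γ) / 2 with hβ
  have hαβ : α < β := by linarith [hγ1.1]
  have hβγ : β < γ := by linarith [hγ1.1]
  have hsmall : ∀ D : ℝ, ∀ᶠ n : ℕ in atTop, 2 * c * D / n < δ := fun D =>
    (tendsto_const_div_atTop_nhds_zero_nat _).eventually (gt_mem_nhds hδ)
  filter_upwards [hγL.1.eventually (lt_mem_nhds hLγ),
    hαL.1.eventually (gt_mem_nhds (by linarith : L α < L α + δ)),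
    hsmall (γ / (γ - β) ^ 2), hsmall (α / (β - α) ^ 2), eventually_gt_atTop 0] with n b1 b2 d1 d2 hn
  have hn' : (0 : ℝ) < n := by exact_mod_cast hn
  have hcn : 0 ≤ 2 * c * n := by positivity
  set a := A n ⌊α * n⌋₊ with ha
  set a' := A n ⌊β * n⌋₊ with ha'
  have haa : a' ≤ a := hA n hn (Nat.floor_mono (by gcongr))
  have ha'0 : 0 ≤ a' := hA0 n hn _
  have ha'1 : a' ≤ 2 * c * n := hA1 n hn _
  have up : poisMean (γ * n) (A n) ≤ a' + 2 * c * n * poisProb (γ * n) (fun m => m < ⌊β * n⌋₊) +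
      0 * poisProb (γ * n) (fun m => m < ⌊β * n⌋₊) := by
    refine poisMean_le_affine (by nlinarith) (habs n hn) _ _ _ _ _ fun m => ?_
    by_cases hm : m < ⌊β * n⌋₊
    · simp only [hm, if_true]
      linarith [hA1 n hn m]
    · simp only [hm, if_false]
      linarith [hA n hn (not_lt.mp hm)]
  have lo : a' + (a - a') * poisProb (α * n) (fun m => m ≤ ⌊α * n⌋₊) +
      -(2 * c * n) * poisProb (α * n) (fun m => ⌊β * n⌋₊ < m) ≤ poisMean (α * n) (A n) := by
    refine affine_le_poisMean (by positivity) (habs n hn) _ _ _ _ _ fun m => ?_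
    have hfl : ⌊α * (n : ℝ)⌋₊ ≤ ⌊β * (n : ℝ)⌋₊ := Nat.floor_mono (by gcongr)
    by_cases hm : m ≤ ⌊α * n⌋₊
    · have hm' : ¬ ⌊β * n⌋₊ < m := by omega
      simp only [hm, hm', if_true, if_false]
      linarith [hA n hn hm]
    · by_cases hm' : ⌊β * n⌋₊ < m
      · simp only [hm, hm', if_true, if_false]
        linarith [hA0 n hn m]
      · simp only [hm, hm', if_false]
        linarith [hA n hn (not_lt.mp hm')]
  have p1 := poisProb_lt_floor (hα.trans hαβ.le) hβγ hn
  have p2 := poisProb_gt_floor hα hαβ hn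
  have p3 := le_poisProb_le_floor (show 0 ≤ α * (n : ℝ) by positivity)
  rw [div_lt_iff₀ hn'] at d1 d2 b2
  rw [lt_div_iff₀ hn'] at b1
  have q1 := mul_le_mul_of_nonneg_left p1 hcn
  have q2 := mul_le_mul_of_nonneg_left p2 hcn
  have q3 := mul_le_mul_of_nonneg_left p3 (sub_nonneg.mpr haa)
  rw [← hκ] at q3
  have r1 : 2 * c * n * (γ / (γ - β) ^ 2 / n) = 2 * c * (γ / (γ - β) ^ 2) := by
    field_simp
  have r2 : 2 * c * n * (α / (β - α) ^ 2 / n) = 2 * c * (α / (β - α) ^ 2) := by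
    field_simp
  rw [r1] at q1
  rw [r2] at q2
  have low : (L α - 3 * δ) * n ≤ a' := by linarith
  have q4 : 0 ≤ (a - a') * κ := mul_nonneg (sub_nonneg.mpr haa) hκ0.le
  have high : a' ≤ (L α + 2 * δ) * n := by linarith
  have gap : (a - a') * κ ≤ 5 * δ * n := by linarith
  constructor
  · rw [le_div_iff₀ hn']; linarith
  · rw [div_le_iff₀ hn']
    have : a - a' ≤ 5 / κ * δ * n := by
      rw [← le_div_iff₀ hκ0] at gap
      exact gap.trans (le_of_eq (by ring))
    linarith

lemma rpow_le_mul_two_pow (s : ℝ) : ∃ B : ℝ, 0 < B ∧ ∀ j : ℕ, ((j : ℝ) + 1) ^ s ≤ B * 2 ^ j := by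
  obtain ⟨k, hk⟩ := exists_nat_ge s
  have h1 := (tendsto_pow_const_div_const_pow_of_one_lt k (show (1 : ℝ) < 2 by norm_num))
  obtain ⟨B, hB⟩ := h1.bddAbove_range
  refine ⟨2 * max B 1, by positivity, fun j => ?_⟩
  have h2 := hB ⟨j + 1, rfl⟩
  simp only at h2
  rw [div_le_iff₀ (by positivity)] at h2
  push_cast at h2
  calc ((j : ℝ) + 1) ^ s ≤ ((j : ℝ) + 1) ^ (k : ℝ) :=
        Real.rpow_le_rpow_of_exponent_le (by linarith [(Nat.cast_nonneg j : (0 : ℝ) ≤ j)]) hk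
    _ = ((j : ℝ) + 1) ^ k := Real.rpow_natCast _ _
    _ ≤ B * 2 ^ (j + 1) := h2
    _ ≤ max B 1 * 2 ^ (j + 1) := by gcongr; exact le_max_left _ _
    _ = _ := by ring

lemma log_two_add_one_le {n : ℕ} (hn : 2 ≤ n) :
    (Nat.log 2 n : ℝ) + 1 ≤ 2 / Real.log 2 * Real.log n := by
  have hl : 0 < Real.log 2 := Real.log_pos (by norm_num)
  have h1 : (2 : ℝ) ^ Nat.log 2 n ≤ n := by exact_mod_cast Nat.pow_log_le_self 2 (by omega)
  have h2 := Real.log_le_log (by positivity) h1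
  rw [Real.log_pow] at h2
  have h3 : (1 : ℝ) ≤ Nat.log 2 n := by exact_mod_cast Nat.log_pos (by norm_num) hn
  rw [div_mul_eq_mul_div, le_div_iff₀ hl]
  nlinarith

/-- Unsatisfiability bounds for a fixed number of clauses transfer to slightly smaller Poisson
numbers of clauses, uniformly in the density. -/
lemma exists_poisMean_unsatProb_le {k : ℕ} {μ : CT k → ℝ} (hμ : IsPMF μ) {α₁ α' ε C : ℝ}
    (hα₁ : 0 ≤ α₁) (hα' : α₁ < α') (hε : 0 < ε)
    (hP : ∀ᶠ n : ℕ in atTop, PnG k n α' 0 μ ≤ C / Real.log n ^ (1 + ε)) :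
    ∃ K : ℝ, 0 ≤ K ∧ ∀ β ∈ Set.Icc 0 α₁, ∀ n : ℕ, 1 ≤ n →
      poisMean (β * n) (unsatProb μ n) ≤ K / ((Nat.log 2 n : ℝ) + 1) ^ (1 + ε) := by
  have hl : 0 < Real.log 2 := Real.log_pos (by norm_num)
  obtain ⟨B, hB0, hB⟩ := rpow_le_mul_two_pow (1 + ε)
  obtain ⟨M, hM⟩ := eventually_atTop.mp hP
  set D : ℝ := α₁ / (α' - α₁) ^ 2 with hD
  have hD0 : 0 ≤ D := by positivity
  set M' := max M 2 with hM'
  refine ⟨|C| * (2 / Real.log 2) ^ (1 + ε) + D * B + ((Nat.log 2 M' : ℝ) + 1) ^ (1 + ε),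
    by positivity, fun β hβ n hn => ?_⟩
  have hn' : (0 : ℝ) < n := by exact_mod_cast hn
  have hlam : 0 ≤ β * n := mul_nonneg hβ.1 hn'.le
  have hL0 : (0 : ℝ) < (Nat.log 2 n : ℝ) + 1 := by positivity
  have hLp : 0 < ((Nat.log 2 n : ℝ) + 1) ^ (1 + ε) := Real.rpow_pos_of_pos hL0 _
  rw [le_div_iff₀ hLp]
  have t1 : 0 ≤ |C| * (2 / Real.log 2) ^ (1 + ε) := by positivity
  have t2 : 0 ≤ D * B := by positivity
  rcases lt_or_ge n M' with hnM | hnM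
  · have h1 : poisMean (β * n) (unsatProb μ n) ≤ 1 := by
      rw [← poisMean_const (β * n) 1]
      exact poisMean_le hlam (abs_unsatProb_le hμ hn) (fun _ => (abs_one (α := ℝ)).le)
        (unsatProb_le_one hμ hn)
    have h2 : ((Nat.log 2 n : ℝ) + 1) ^ (1 + ε) ≤ ((Nat.log 2 M' : ℝ) + 1) ^ (1 + ε) := by
      have : (Nat.log 2 n : ℝ) ≤ Nat.log 2 M' := by exact_mod_cast Nat.log_mono_right hnM.le
      gcongr
    nlinarith
  · have hn2 : 2 ≤ n := (le_max_right _ _).trans hnM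
    have hlogn : 0 < Real.log n := Real.log_pos (by exact_mod_cast hn2)
    have h1 := hM n ((le_max_left _ _).trans hnM)
    rw [PnG_zero_eq] at h1
    have h2 := poisMean_le_affine hlam (abs_unsatProb_le hμ hn) (fun m => ⌊α' * n⌋₊ < m)
      (fun m => ⌊α' * n⌋₊ < m) (unsatProb μ n ⌊α' * n⌋₊) 1 0 (fun m => by
        by_cases hm : ⌊α' * n⌋₊ < m
        · simp only [hm, if_true]
          linarith [unsatProb_le_one hμ hn m, unsatProb_nonneg hμ hn ⌊α' * n⌋₊]
        · simp only [hm, if_false]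
          linarith [unsatProb_monotone hμ hn (not_lt.mp hm)])
    have h3 : poisProb (β * n) (fun m => ⌊α' * n⌋₊ < m) ≤ D / n := by
      refine (poisProb_gt_floor hβ.1 (hβ.2.trans_lt hα') hn).trans ?_
      have : 0 < α' - α₁ := by linarith
      rw [hD]
      gcongr
      · exact hβ.2
      · exact hβ.2
    have h4 : D / n * ((Nat.log 2 n : ℝ) + 1) ^ (1 + ε) ≤ D * B := by
      have e1 : (2 : ℝ) ^ Nat.log 2 n ≤ n := by exact_mod_cast Nat.pow_log_le_self 2 (by omega)
      have e2 : ((Nat.log 2 n : ℝ) + 1) ^ (1 + ε) ≤ B * n :=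
        (hB _).trans (mul_le_mul_of_nonneg_left e1 hB0.le)
      calc _ ≤ D / n * (B * n) := by gcongr
        _ = D * B := by field_simp
    have h5 : C / Real.log n ^ (1 + ε) * ((Nat.log 2 n : ℝ) + 1) ^ (1 + ε) ≤
        |C| * (2 / Real.log 2) ^ (1 + ε) := by
      have e1 : ((Nat.log 2 n : ℝ) + 1) ^ (1 + ε) ≤
          (2 / Real.log 2) ^ (1 + ε) * Real.log n ^ (1 + ε) := by
        rw [← Real.mul_rpow (by positivity) hlogn.le]
        exact Real.rpow_le_rpow hL0.le (log_two_add_one_le hn2) (by linarith)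
      have e2 : 0 < Real.log n ^ (1 + ε) := Real.rpow_pos_of_pos hlogn _
      calc _ ≤ |C| / Real.log n ^ (1 + ε) *
            ((2 / Real.log 2) ^ (1 + ε) * Real.log n ^ (1 + ε)) := by
              gcongr
              exact le_abs_self C
        _ = _ := by field_simp
    have h6 : 0 ≤ ((Nat.log 2 M' : ℝ) + 1) ^ (1 + ε) := by positivity
    have h7 : poisMean (β * n) (unsatProb μ n) ≤ C / Real.log n ^ (1 + ε) + D / n := by linarith
    have h8 := mul_le_mul_of_nonneg_right h7 hLp.le
    linarith

lemma summable_div_rpow (K : ℝ) {s : ℝ} (hs : 1 < s) :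
    Summable fun j : ℕ => K / ((j : ℝ) + 1) ^ s := by
  have h := (summable_nat_add_iff 1).mpr (Real.summable_one_div_nat_rpow.mpr hs)
  refine (h.mul_left K).congr fun j => ?_
  push_cast
  rw [mul_one_div]

lemma exists_tendsto_meanLog {k : ℕ} {μ : CT k → ℝ} (hμ : IsPMF μ) (h2 : H2 k μ) {α α' ε C : ℝ}
    (hα : 0 ≤ α) (hα' : α < α') (hε : 0 < ε)
    (hP : ∀ᶠ n : ℕ in atTop, PnG k n α' 0 μ ≤ C / Real.log n ^ (1 + ε)) :
    ∃ L, Tendsto (fun n : ℕ => meanLog μ n ⌊α * n⌋₊ / n) atTop (𝓝 L) := by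
  have hc : 0 ≤ Real.log 2 := (Real.log_pos (by norm_num)).le
  set α₁ := (α + α') / 2 with hα₁
  obtain ⟨K, hK0, hK⟩ := exists_poisMean_unsatProb_le hμ (by linarith : 0 ≤ α₁)
    (by linarith : α₁ < α') hε hP
  set g : ℕ → ℝ := fun j => K / ((j : ℝ) + 1) ^ (1 + ε) with hg
  have hg_anti : Antitone g := fun i j hij => by
    have : (i : ℝ) ≤ j := by exact_mod_cast hij
    show K / ((j : ℝ) + 1) ^ (1 + ε) ≤ K / ((i : ℝ) + 1) ^ (1 + ε)
    gcongr
  have hg0 : ∀ j, 0 ≤ g j := fun j => by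
    show 0 ≤ K / ((j : ℝ) + 1) ^ (1 + ε)
    positivity
  have hub : ∀ n, 0 < n → ∀ m, meanLog μ n m ≤ 2 * Real.log 2 * n := fun n hn m => by
    have : (1 : ℝ) ≤ n := by exact_mod_cast hn
    nlinarith [meanLog_le hμ hn m]
  have key : ∀ β ∈ Set.Icc α α₁, ∃ L,
      Tendsto (fun n : ℕ => poisMean (β * n) (meanLog μ n) / n) atTop (𝓝 L) ∧
      ∀ N : ℕ, 2 ≤ N → poisMean (β * N) (meanLog μ N) / N - superErr (Real.log 2) g N ≤ L := by
    intro β hβ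
    have hβ0 : 0 ≤ β := hα.trans hβ.1
    refine exists_tendsto_of_superadd (b := fun n => poisMean (β * n) (meanLog μ n)) hc hg_anti hg0
      (summable_div_rpow K (by linarith)) (fun n hn => ?_) (fun n hn => ?_) fun n₁ n₂ h₁ h₂ => ?_
    · show 0 ≤ poisMean (β * n) (meanLog μ n)
      rw [← poisMean_const (β * n) 0]
      exact poisMean_le (by positivity) (fun _ => (abs_zero (α := ℝ)).le) (abs_meanLog_le hμ hn)
        (meanLog_nonneg hμ hn)
    · show poisMean (β * n) (meanLog μ n) ≤ 2 * Real.log 2 * n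
      rw [← poisMean_const (β * n) (2 * Real.log 2 * n)]
      exact poisMean_le (by positivity) (abs_meanLog_le hμ hn) (fun _ => le_rfl) (hub n hn)
    · have h := poisMean_meanLog_add_le hμ h2 h₁ h₂ hβ0
      have u₁ := hK β ⟨hβ0, hβ.2⟩ n₁ h₁
      have u₂ := hK β ⟨hβ0, hβ.2⟩ n₂ h₂
      have v₁ : ((n₂ : ℝ) + 1) * Real.log 2 * poisMean (β * n₁) (unsatProb μ n₁) ≤
          (n₂ + 1) * Real.log 2 * g (Nat.log 2 n₁) :=
        mul_le_mul_of_nonneg_left u₁ (by positivity)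
      have v₂ : ((n₁ : ℝ) + 1) * Real.log 2 * poisMean (β * n₂) (unsatProb μ n₂) ≤
          (n₁ + 1) * Real.log 2 * g (Nat.log 2 n₂) :=
        mul_le_mul_of_nonneg_left u₂ (by positivity)
      show poisMean (β * n₁) (meanLog μ n₁) + poisMean (β * n₂) (meanLog μ n₂) ≤
        poisMean (β * (n₁ + n₂ : ℕ)) (meanLog μ (n₁ + n₂)) + 2 * Real.log 2 + _ + _
      linarith
  choose! L hL using key
  exact ⟨L α, tendsto_of_poisMean hc (fun n hn => meanLog_antitone hμ hn)
    (fun n hn => meanLog_nonneg hμ hn) hub hα (by linarith : α < α₁)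
    (tendsto_superErr (Real.log 2) g) hL⟩

lemma tendsto_unsatProb {k : ℕ} {μ : CT k → ℝ} (hμ : IsPMF μ) {α α' ε C : ℝ} (hα' : α < α')
    (hε : 0 < ε) (hP : ∀ᶠ n : ℕ in atTop, PnG k n α' 0 μ ≤ C / Real.log n ^ (1 + ε)) :
    Tendsto (fun n : ℕ => unsatProb μ n ⌊α * n⌋₊) atTop (𝓝 0) := by
  have h1 : Tendsto (fun n : ℕ => C / Real.log n ^ (1 + ε)) atTop (𝓝 0) :=
    ((tendsto_rpow_atTop (by linarith : 0 < 1 + ε)).comp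
      (Real.tendsto_log_atTop.comp tendsto_natCast_atTop_atTop)).const_div_atTop C
  refine tendsto_of_tendsto_of_tendsto_of_le_of_le' tendsto_const_nhds h1 ?_ ?_
  · filter_upwards [eventually_gt_atTop 0] with n hn
    exact unsatProb_nonneg hμ hn _
  · filter_upwards [hP, eventually_gt_atTop 0] with n h hn
    rw [PnG_zero_eq] at h
    exact (unsatProb_monotone hμ hn (Nat.floor_mono (by gcongr))).trans h

/-- **Convergence of the expected log-number of solutions for general random CSPs.**
If `μ` satisfies H2 then for every `α ∈ [0, α*(μ))`, the sequence
`ψ_n(α) = (1/n) E[log Z(F(α,n,μ)) | Z(F(α,n,μ)) ≥ 1]` converges to a limit `φ_s(α)`. -/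
theorem csp_psin_converges (k : ℕ) (hk : 2 ≤ k) (μ : CT k → ℝ) (hμ : IsPMF μ)
    (h2 : H2 k μ) (α : ℝ) (hα0 : 0 ≤ α) (hα : α < alphaStarG k μ) :
    ∃ φs : ℝ, Tendsto (fun n : ℕ => psinG k n α μ) atTop (𝓝 φs) := by
  have hne : {α : ℝ | ∃ ε : ℝ, 0 < ε ∧ ∃ C : ℝ,
      ∀ᶠ (n : ℕ) in atTop, PnG k n α 0 μ ≤ C / Real.log n ^ (1 + ε)}.Nonempty := by
    by_contra hne
    rw [Set.not_nonempty_iff_eq_empty] at hne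
    unfold alphaStarG at hα
    rw [hne, Real.sSup_empty] at hα
    linarith
  obtain ⟨α', ⟨ε, hε, C, hP⟩, hα'⟩ := exists_lt_of_lt_csSup hne hα
  obtain ⟨L, hL⟩ := exists_tendsto_meanLog hμ h2 hα0 hα' hε hP
  have hu := tendsto_unsatProb hμ hα' hε hP
  have hu1 : Tendsto (fun n : ℕ => 1 - unsatProb μ n ⌊α * n⌋₊) atTop (𝓝 1) := by
    simpa using hu.const_sub 1
  have hlow : Tendsto (fun n : ℕ => (meanLog μ n ⌊α * n⌋₊ / n - Real.log 2 / n) /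
      (1 - unsatProb μ n ⌊α * n⌋₊)) atTop (𝓝 L) := by
    have h := (hL.sub (tendsto_const_div_atTop_nhds_zero_nat (Real.log 2))).div hu1 one_ne_zero
    rw [sub_zero, div_one] at h
    exact h
  have hupp : Tendsto (fun n : ℕ => meanLog μ n ⌊α * n⌋₊ / n /
      (1 - unsatProb μ n ⌊α * n⌋₊)) atTop (𝓝 L) := by
    have h := hL.div hu1 one_ne_zero
    rw [div_one] at h
    exact h
  refine ⟨L, tendsto_of_tendsto_of_tendsto_of_le_of_le' hlow hupp ?_ ?_⟩
  · filter_upwards [hu.eventually (gt_mem_nhds one_pos), eventually_gt_atTop 0] with n h hn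
    refine le_trans (le_of_eq ?_) (psinG_bounds hμ hn α h).1
    ring
  · filter_upwards [hu.eventually (gt_mem_nhds one_pos), eventually_gt_atTop 0] with n h hn
    refine le_trans (psinG_bounds hμ hn α h).2 (le_of_eq ?_)
    ring
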